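/- Every double Schubert polynomial has the Saturated Newton Polytope property: for every permutation π ∈ S_p, supp(𝔖_π) = Newton(𝔖_π) ∩ ℕ^{2p}, i.e., the support of 𝔖_π consists exactly of the lattice points of its Newton polytope. -/

import Mathlib

open MvPolynomial

/-- The Coxeter length of a permutation of `Fin p`, i.e. its number of inversions. -/
def permLength {p : ℕ} (π : Equiv.Perm (Fin p)) : ℕ :=
  (Finset.univ.filter (fun q : Fin p × Fin p => q.1 < q.2 ∧ π q.2 < π q.1)).card

/-- The defining recursion for the family of double Schubert polynomials
`𝔖 : Equiv.Perm (Fin p) → ℤ[t₁,…,t_p,s₁,…,s_p]`, where the variable `X (Sum.inl i)`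
plays the role of `t_{i+1}` and `X (Sum.inr j)` plays the role of `s_{j+1}`:
`𝔖 π₀ = ∏_{i+j ≤ p} (t_i - s_j)` for the longest permutation `π₀` (which is `Fin.revPerm`),
and `(t_i - t_{i+1}) ⬝ 𝔖 (𝔰_i π) = 𝔖 π - 𝔰_i ⬝ 𝔖 π` whenever `ℓ(𝔰_i π) < ℓ(π)`,
where the simple transposition `𝔰_i` acts on polynomials by permuting the `t`-variables. -/
def IsDoubleSchubertFamily (p : ℕ)
    (𝔖 : Equiv.Perm (Fin p) → MvPolynomial (Fin p ⊕ Fin p) ℤ) : Prop :=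
  (𝔖 Fin.revPerm =
      ∏ q ∈ Finset.univ.filter (fun q : Fin p × Fin p => (q.1 : ℕ) + (q.2 : ℕ) + 2 ≤ p),
        (X (Sum.inl q.1) - X (Sum.inr q.2))) ∧
  (∀ (π : Equiv.Perm (Fin p)) (i : Fin p) (h : (i : ℕ) + 1 < p),
    permLength (Equiv.swap i ⟨(i : ℕ) + 1, h⟩ * π) < permLength π →
      (X (Sum.inl i) - X (Sum.inl ⟨(i : ℕ) + 1, h⟩)) *
          𝔖 (Equiv.swap i ⟨(i : ℕ) + 1, h⟩ * π)
        = 𝔖 π - MvPolynomial.rename (Sum.map (Equiv.swap i ⟨(i : ℕ) + 1, h⟩) id) (𝔖 π))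

/-- **Rado's theorem** for an integer-valued monotone submodular function. -/
theorem exists_transversal_of_card_le_biUnion {ι α : Type*} [Fintype ι] [DecidableEq ι]
    [DecidableEq α] (ρ : Finset α → ℕ) (h_empty : ρ ∅ = 0)
    (h_mono : ∀ A B, A ⊆ B → ρ A ≤ ρ B)
    (h_submod : ∀ A B, ρ (A ∪ B) + ρ (A ∩ B) ≤ ρ A + ρ B)
    (A : ι → Finset α) (hA : ∀ J : Finset ι, J.card ≤ ρ (J.biUnion A)) :
    ∃ f : ι → α, (∀ i, f i ∈ A i) ∧ Fintype.card ι ≤ ρ (Finset.univ.image f) := by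
  induction hN : ∑ i, (A i).card using Nat.strong_induction_on generalizing A with
  | _ N ih =>
  by_cases hbig : ∃ i, 1 < (A i).card
  · obtain ⟨i, hi⟩ := hbig
    obtain ⟨x, hx, y, hy, hxy⟩ := Finset.one_lt_card.mp hi
    have key : ∀ z ∈ A i, (∀ J : Finset ι, J.card ≤
          ρ (J.biUnion (Function.update A i ((A i).erase z)))) →
        ∃ f : ι → α, (∀ i, f i ∈ A i) ∧ Fintype.card ι ≤ ρ (Finset.univ.image f) := by
      intro z hz hJ
      have hlt : ∑ j, (Function.update A i ((A i).erase z) j).card < N := by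
        rw [← hN]
        refine Finset.sum_lt_sum (fun j _ => ?_) ⟨i, Finset.mem_univ _, ?_⟩
        · by_cases hj : j = i
          · subst hj; simpa using Finset.card_le_card (Finset.erase_subset _ _)
          · simp [Function.update_of_ne hj]
        · simpa using Finset.card_erase_lt_of_mem hz
      obtain ⟨f, hf, hcard⟩ := ih _ hlt _ hJ rfl
      refine ⟨f, fun j => ?_, hcard⟩
      by_cases hj : j = i
      · subst hj
        have := hf j
        simp only [Function.update_self] at this
        exact Finset.mem_of_mem_erase this
      · have := hf j
        rwa [Function.update_of_ne hj] at this
    by_contra hno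
    have viol : ∀ z ∈ A i, ∃ I : Finset ι, i ∉ I ∧
        ρ (I.biUnion A ∪ (A i).erase z) ≤ I.card := by
      intro z hz
      obtain ⟨J, hJ⟩ := not_forall.mp fun h => hno (key z hz h)
      have hiJ : i ∈ J := by
        by_contra hiJ
        have : J.biUnion (Function.update A i ((A i).erase z)) = J.biUnion A :=
          Finset.biUnion_congr rfl fun j hj =>
            Function.update_of_ne (ne_of_mem_of_not_mem hj hiJ) _ _
        rw [this] at hJ
        exact hJ (hA J)
      refine ⟨J.erase i, Finset.notMem_erase i J, ?_⟩
      have hc := Finset.card_erase_add_one hiJ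
      have : (J.erase i).biUnion A ∪ (A i).erase z ⊆
          J.biUnion (Function.update A i ((A i).erase z)) := by
        intro a ha
        rcases Finset.mem_union.mp ha with ha | ha
        · obtain ⟨j, hj, haj⟩ := Finset.mem_biUnion.mp ha
          refine Finset.mem_biUnion.mpr ⟨j, Finset.mem_of_mem_erase hj, ?_⟩
          rwa [Function.update_of_ne (Finset.ne_of_mem_erase hj)]
        · exact Finset.mem_biUnion.mpr ⟨i, hiJ, by simpa using ha⟩
      have := h_mono _ _ this
      omega
    obtain ⟨I₁, hi₁, h₁⟩ := viol x hx
    obtain ⟨I₂, hi₂, h₂⟩ := viol y hy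
    have hs := h_submod (I₁.biUnion A ∪ (A i).erase x) (I₂.biUnion A ∪ (A i).erase y)
    have hu := h_mono ((insert i (I₁ ∪ I₂)).biUnion A)
      ((I₁.biUnion A ∪ (A i).erase x) ∪ (I₂.biUnion A ∪ (A i).erase y)) (by
        intro a ha
        simp only [Finset.mem_biUnion, Finset.mem_insert, Finset.mem_union, Finset.mem_erase]
          at ha ⊢
        obtain ⟨j, rfl | hj | hj, ha⟩ := ha
        · by_cases hax : a = x
          · exact Or.inr (Or.inr ⟨fun h => hxy (hax ▸ h), ha⟩)
          · exact Or.inl (Or.inr ⟨hax, ha⟩)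
        · exact Or.inl (Or.inl ⟨j, hj, ha⟩)
        · exact Or.inr (Or.inl ⟨j, hj, ha⟩))
    have hn := h_mono ((I₁ ∩ I₂).biUnion A)
      ((I₁.biUnion A ∪ (A i).erase x) ∩ (I₂.biUnion A ∪ (A i).erase y)) (by
        intro a ha
        simp only [Finset.mem_biUnion, Finset.mem_inter, Finset.mem_union] at ha ⊢
        obtain ⟨j, ⟨hj₁, hj₂⟩, ha⟩ := ha
        exact ⟨Or.inl ⟨j, hj₁, ha⟩, Or.inl ⟨j, hj₂, ha⟩⟩)
    have c₁ := hA (insert i (I₁ ∪ I₂))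
    rw [Finset.card_insert_of_notMem (by simp [hi₁, hi₂])] at c₁
    have c₂ := hA (I₁ ∩ I₂)
    have := Finset.card_union_add_card_inter I₁ I₂
    omega
  · push Not at hbig
    have hne : ∀ i, (A i).Nonempty := by
      intro i
      rw [Finset.nonempty_iff_ne_empty]
      intro h
      have := hA {i}
      simp [h, h_empty] at this
    choose f hf using hne
    refine ⟨f, hf, ?_⟩
    have h1 := hA Finset.univ
    rw [Finset.card_univ] at h1
    refine h1.trans (h_mono _ _ ?_)
    intro a ha
    obtain ⟨i, -, hi⟩ := Finset.mem_biUnion.mp ha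
    exact Finset.mem_image.mpr ⟨i, Finset.mem_univ _,
      Finset.card_le_one.mp (hbig i) _ (hf i) _ hi⟩

theorem AlgebraicIndependent.aeval_of_substitution {ι ι' R A : Type*} [CommRing R] [CommRing A]
    [Algebra R A] {x : ι → A} (hx : AlgebraicIndependent R x) {f : ι' → MvPolynomial ι R}
    (hf : AlgebraicIndependent R f) : AlgebraicIndependent R fun i => aeval x (f i) := by
  rw [algebraicIndependent_iff] at hx hf ⊢
  intro p hp
  refine hf _ (hx _ ?_)
  rwa [← aeval_comp_bind₁, AlgHom.comp_apply] at hp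

/-- Adjoining a nonzero element of the kernel of a specialization to a family which stays
algebraically independent after specialization yields an algebraically independent family. -/
theorem AlgebraicIndependent.option_of_specialization {ι R S S' : Type*} [CommRing R] [CommRing S]
    [NoZeroDivisors S] [CommRing S'] [Algebra R S] [Algebra R S'] (φ : S →ₐ[R] S') {a : S}
    {b : ι → S} (ha : a ≠ 0) (hφa : φ a = 0) (hb : AlgebraicIndependent R (φ ∘ b)) :
    AlgebraicIndependent R (fun o : Option ι => o.elim a b) := by
  have hb' : AlgebraicIndependent R b := AlgebraicIndependent.of_comp φ hb
  rw [hb'.option_iff_transcendental]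
  have hinj : ∀ y ∈ Algebra.adjoin R (Set.range b), φ y = 0 → y = 0 := by
    intro y hy h
    rw [Algebra.adjoin_range_eq_range_aeval] at hy
    obtain ⟨P, rfl⟩ := hy
    have : aeval (φ ∘ b) P = 0 := by
      rw [← h]
      exact (map_aeval b φ.toRingHom P).symm ▸ by
        rw [aeval_def]; congr 1; ext r; simp
    rw [hb.eq_zero_of_aeval_eq_zero _ this, map_zero]
  intro halg
  obtain ⟨q, hq0, hq⟩ := halg
  obtain ⟨q', hq', hdvd⟩ := Polynomial.exists_eq_pow_rootMultiplicity_mul_and_not_dvd q hq0 0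
  rw [hq', map_mul, map_pow, mul_eq_zero] at hq
  have hq2 : Polynomial.aeval a q' = 0 := by
    rcases hq with hq | hq
    · exact absurd (eq_zero_of_pow_eq_zero hq) (by simpa using ha)
    · exact hq
  apply hdvd
  rw [map_zero, sub_zero, Polynomial.X_dvd_iff]
  have h1 := congrArg φ hq2
  rw [map_zero, ← Polynomial.divX_mul_X_add q'] at h1
  simp only [map_add, map_mul, Polynomial.aeval_X, hφa, mul_zero, zero_add,
    Polynomial.aeval_C] at h1
  exact Subtype.ext (hinj _ (q'.coeff 0).2 h1)

theorem AlgebraicIndependent.units_smul {ι K A : Type*} [Field K] [CommRing A] [Algebra K A]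
    {x : ι → A} (hx : AlgebraicIndependent K x) (u : ι → K) (hu : ∀ i, u i ≠ 0) :
    AlgebraicIndependent K fun i => algebraMap K A (u i) * x i := by
  have : AlgebraicIndependent K (fun i => C (u i) * X i : ι → MvPolynomial ι K) := by
    refine AlgebraicIndependent.of_comp
      (aeval (fun i => C (u i)⁻¹ * X i) : MvPolynomial ι K →ₐ[K] MvPolynomial ι K) ?_
    convert algebraicIndependent_X ι K using 1
    ext1 i
    simp only [Function.comp_apply, map_mul, aeval_X, algHom_C, algebraMap_eq]
    rw [← mul_assoc, ← C_mul, mul_inv_cancel₀ (hu i), C_1, one_mul]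
  convert hx.aeval_of_substitution this using 2 with i
  simp

theorem AlgebraicIndependent.ringHom_comp_int {ι A A' : Type*} [CommRing A] [CommRing A']
    {x : ι → A} (hx : AlgebraicIndependent ℤ x) (f : A →+* A') (hf : Function.Injective f) :
    AlgebraicIndependent ℤ fun i => f (x i) :=
  hx.map' (f := f.toIntAlgHom) hf

/-- Given points `y e` whose coordinates `y e (t e)` are jointly algebraically independent, the
coefficients of generic linear forms and their values at the points are jointly algebraically
independent. -/
theorem exists_algebraicIndependent_coeffs_and_values {ι κ : Type} [Fintype κ] [DecidableEq κ]
    {E₀ : Type} [Field E₀] (y : ι → κ → E₀) (t : ι → κ)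
    (h : AlgebraicIndependent ℤ fun e => y e (t e)) :
    ∃ (F : Type) (_ : Field F) (φ : E₀ →+* F) (lam : ι → κ → F),
      AlgebraicIndependent ℤ (Sum.elim (fun e : ι × κ => lam e.1 e.2)
        (fun e => ∑ l, lam e l * φ (y e l))) := by
  let S := MvPolynomial (Option (ι × κ)) E₀
  let δ : ι → κ → ℤ := fun e l => if l = t e then 1 else 0
  let L : ι → κ → S := fun e l => (δ e l : S) + X none * X (some (e, l))
  let M : ι × κ → S := fun e => X (some e)
  let θ : ι → S := fun e => ∑ l, L e l * C (y e l)
  have hspec : AlgebraicIndependent ℤ (fun o : Option ((ι × κ) ⊕ ι) =>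
      o.elim (X none : S) (Sum.elim M θ)) := by
    let φ : S →ₐ[ℤ] MvPolynomial (ι × κ) E₀ :=
      ((aeval (fun o => o.elim 0 X) : S →ₐ[E₀] MvPolynomial (ι × κ) E₀)).restrictScalars ℤ
    have hφX : ∀ o, φ (X o) = o.elim 0 X := fun o => aeval_X _ _
    have hφC : ∀ a, φ (C a) = C a := fun a => aeval_C _ _
    clear_value φ
    refine AlgebraicIndependent.option_of_specialization φ (X_ne_zero _) ?_ ?_
    · rw [hφX]; rfl
    · have := AlgebraicIndependent.sumElim_comp h (algebraicIndependent_X (ι × κ) E₀)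
      convert this using 1
      ext1 (e | e)
      · simp [M, hφX]
      · simp [θ, L, δ, algebraMap_eq, hφX, hφC]
  have hsub : AlgebraicIndependent ℤ (Sum.elim
      (fun e : ι × κ => (C (δ e.1 e.2) + X none * X (some (Sum.inl e))))
      (fun e => X (some (Sum.inr e))) :
        (ι × κ) ⊕ ι → MvPolynomial (Option ((ι × κ) ⊕ ι)) ℤ) := by
    refine AlgebraicIndependent.of_comp
      (aeval (fun o => o.elim 1 (Sum.elim (fun e => X (Sum.inl e) - C (δ e.1 e.2))
        (fun e => X (Sum.inr e)))) :
        MvPolynomial (Option ((ι × κ) ⊕ ι)) ℤ →ₐ[ℤ] MvPolynomial ((ι × κ) ⊕ ι) ℤ) ?_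
    convert algebraicIndependent_X ((ι × κ) ⊕ ι) ℤ using 1
    ext1 (e | e) <;> simp
  have hL := hspec.aeval_of_substitution hsub
  obtain ⟨F, _, f, hf⟩ : ∃ (F : Type) (_ : Field F) (f : S →+* F), Function.Injective f :=
    ⟨FractionRing S, inferInstance, algebraMap _ _, IsFractionRing.injective _ _⟩
  refine ⟨F, inferInstance, f.comp C, fun e l => f (L e l), ?_⟩
  convert hL.ringHom_comp_int f hf using 1
  ext1 (e | e)
  · simp [L, M]
  · simp [θ]

section RankCondition

variable {n : ℕ}

/-- The number of rows `a ≤ r` with `w a ≤ c`. -/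
def cornerRank (w : Equiv.Perm (Fin n)) (r c : Fin n) : ℕ :=
  (Finset.univ.filter fun a => a ≤ r ∧ w a ≤ c).card

/-- Every set of more than `cornerRank w r c` rows among the first `r` rows of `x` is linearly
dependent when restricted to the first `c` columns. -/
def RankCond {E : Type*} [Field E] (w : Equiv.Perm (Fin n)) (x : Fin n → Fin n → E) : Prop :=
  ∀ r c : Fin n, ∀ A : Finset (Fin n), (∀ a ∈ A, a ≤ r) → cornerRank w r c < A.card →
    ∃ γ : Fin n → E, γ ≠ 0 ∧ (∀ a, a ∉ A → γ a = 0) ∧ ∀ b ≤ c, ∑ a, γ a * x a b = 0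

/-- `k` is a row such that `w * swap i k` covers `w` in Bruhat order, with `i < k`. -/
def IsCover (w : Equiv.Perm (Fin n)) (i k : Fin n) : Prop :=
  i < k ∧ w i < w k ∧ ∀ r, i < r → r < k → ¬ (w i < w r ∧ w r < w k)

variable {E : Type*} [Field E] {w : Equiv.Perm (Fin n)} {x : Fin n → Fin n → E}

theorem exists_dependency_of_zero_row {A : Finset (Fin n)} {a c : Fin n} (ha : a ∈ A)
    (h : ∀ b ≤ c, x a b = 0) :
    ∃ γ : Fin n → E, γ ≠ 0 ∧ (∀ a, a ∉ A → γ a = 0) ∧ ∀ b ≤ c, ∑ a, γ a * x a b = 0 := by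
  refine ⟨Pi.single a 1, by simp, fun b hb => ?_, fun b hb => ?_⟩
  · exact Pi.single_eq_of_ne (ne_of_mem_of_not_mem ha hb).symm _
  · simp [Pi.single_apply, h b hb]

theorem RankCond.scale (h : RankCond w x) (u v : Fin n → E) :
    RankCond w fun a b => u a * v b * x a b := by
  intro r c A hA hcard
  by_cases hu : ∃ a ∈ A, u a = 0
  · obtain ⟨a, ha, hu⟩ := hu
    exact exists_dependency_of_zero_row ha fun b _ => by simp [hu]
  push Not at hu
  obtain ⟨γ, h0, hγA, hγ⟩ := h r c A hA hcard
  refine ⟨fun a => γ a / u a, ?_, fun a ha => by simp [hγA a ha], fun b hb => ?_⟩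
  · intro h
    apply h0
    ext a
    by_cases ha : a ∈ A
    · have := congrFun h a
      simpa [hu a ha] using this
    · exact hγA a ha
  · rw [← mul_zero (v b), ← hγ b hb, Finset.mul_sum]
    refine Finset.sum_congr rfl fun a _ => ?_
    by_cases ha : a ∈ A
    · field_simp [hu a ha]
    · simp [hγA a ha]

theorem ValuationSubring.exists_forall_div_mem (V : ValuationSubring E) {ι : Type*} [Fintype ι]
    (γ : ι → E) (hγ : γ ≠ 0) : ∃ i, γ i ≠ 0 ∧ ∀ j, γ j / γ i ∈ V := by
  obtain ⟨i₀, hi₀⟩ := Function.ne_iff.mp hγ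
  obtain ⟨i, -, hi⟩ := Finset.exists_max_image Finset.univ (fun i => V.valuation (γ i))
    ⟨i₀, Finset.mem_univ _⟩
  have h0 : γ i ≠ 0 := by
    intro h
    have := hi i₀ (Finset.mem_univ _)
    rw [h, map_zero, le_zero_iff, map_eq_zero] at this
    exact hi₀ this
  refine ⟨i, h0, fun j => ?_⟩
  rw [← V.valuation_le_one_iff, map_div₀]
  exact div_le_one_of_le₀ (hi j (Finset.mem_univ _)) zero_le

theorem RankCond.map_of_valuationSubring {V : ValuationSubring E} {F : Type*} [Field F]
    (φ : V →+* F) {y : Fin n → Fin n → V}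
    (h : RankCond w fun a b => (y a b : E)) :
    RankCond w fun a b => φ (y a b) := by
  intro r c A hA hcard
  obtain ⟨γ, h0, hγA, hγ⟩ := h r c A hA hcard
  obtain ⟨i, hi, hdiv⟩ := V.exists_forall_div_mem γ h0
  refine ⟨fun a => φ ⟨_, hdiv a⟩, ?_, fun a ha => ?_, fun b hb => ?_⟩
  · intro h
    have := congrFun h i
    have h1 : (⟨γ i / γ i, hdiv i⟩ : V) = 1 := Subtype.ext (div_self hi)
    simp [h1] at this
  · have h1 : (⟨γ a / γ i, hdiv a⟩ : V) = 0 := Subtype.ext (by simp [hγA a ha])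
    simp [h1]
  · simp only [← map_mul, ← map_sum]
    have : ∑ a, (⟨γ a / γ i, hdiv a⟩ : V) * y a b = 0 := by
      apply Subtype.ext
      have := hγ b hb
      push_cast
      simp only [div_mul_eq_mul_div, ← Finset.sum_div, this, zero_div]
    rw [this, map_zero]

theorem RankCond.eq_zero (h : RankCond w x) {i j : Fin n} (h0 : ∀ a ≤ i, j < w a) :
    x i j = 0 := by
  obtain ⟨γ, hγ0, hγA, hγ⟩ := h i j {i} (by simp) (by
    rw [cornerRank, Finset.card_singleton, Nat.lt_one_iff, Finset.card_eq_zero,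
      Finset.filter_eq_empty_iff]
    rintro a - ⟨ha, hw⟩
    exact absurd (h0 a ha) (not_lt.mpr hw))
  have hi := hγ j le_rfl
  rw [Finset.sum_eq_single i (fun a _ ha => by simp [hγA a (by simpa using ha)])
    (by simp)] at hi
  refine (mul_eq_zero.mp hi).resolve_left fun hz => hγ0 ?_
  ext a
  by_cases ha : a = i
  · rw [ha, hz]; rfl
  · exact hγA a (by simpa using ha)

theorem apply_add_lt_of_initial {i a : Fin n} (hw : ∀ r < i, (w r : ℕ) + r + 1 = n) (ha : i ≤ a) :
    (w a : ℕ) + i + 1 ≤ n := by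
  by_contra hlt
  have h1 := (w a).2
  have hr : n - 1 - (w a : ℕ) < n := by omega
  have h2 := hw ⟨n - 1 - w a, hr⟩ (by rw [Fin.lt_def]; dsimp; omega)
  have h3 : w ⟨n - 1 - w a, hr⟩ = w a := by rw [Fin.ext_iff]; dsimp at h2; omega
  have h4 := congrArg Fin.val (w.injective h3)
  dsimp at h4
  rw [Fin.le_def] at ha
  omega

theorem RankCond.exists_cover (h : RankCond w x) {i j : Fin n}
    (hw : ∀ r < i, (w r : ℕ) + r + 1 = n) (hj : w i = j) (hij : (i : ℕ) + j + 2 ≤ n)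
    (hx : x i j = 0) : ∃ k, IsCover w i k ∧ RankCond (w * Equiv.swap i k) x := by
  classical
  have hκ : n - 1 - (i : ℕ) < n := by omega
  obtain ⟨κ, hκi⟩ : ∃ κ : Fin n, (κ : ℕ) + i + 1 = n := ⟨⟨n - 1 - i, hκ⟩, by dsimp; omega⟩
  have hlarge : ∀ a, i ≤ a → w a ≤ κ := fun a ha => by
    have := apply_add_lt_of_initial hw ha
    rw [Fin.le_def]; omega
  have hsmall : ∀ a < i, κ < w a := fun a ha => by
    have := hw a ha
    rw [Fin.lt_def] at ha ⊢; omega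
  have hjκ : j < κ := by rw [Fin.lt_def]; omega
  have hrow : ∀ a < i, ∀ b ≤ κ, x a b = 0 := fun a ha b hb =>
    h.eq_zero fun a' ha' => lt_of_le_of_lt hb (hsmall a' (lt_of_le_of_lt ha' ha))
  have hi_lt : ∀ b < j, x i b = 0 := fun b hb => h.eq_zero fun a ha => by
    rcases ha.lt_or_eq with ha | rfl
    · exact hb.trans (hjκ.trans (hsmall a ha))
    · rwa [hj]
  obtain ⟨c₀, hjc₀, hc₀κ, hc₀zero, hc₀⟩ : ∃ c₀ : Fin n, j < c₀ ∧ c₀ ≤ κ ∧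
      (∀ b < c₀, x i b = 0) ∧ (x i c₀ ≠ 0 ∨ c₀ = κ) := by
    by_cases hex : ∃ c, c ≤ κ ∧ x i c ≠ 0
    · let s := Finset.univ.filter fun c => c ≤ κ ∧ x i c ≠ 0
      have hs : s.Nonempty := by
        obtain ⟨c, hc⟩ := hex
        exact ⟨c, by simpa [s] using hc⟩
      have hmin := s.min'_mem hs
      simp only [s, Finset.mem_filter, Finset.mem_univ, true_and] at hmin
      refine ⟨s.min' hs, ?_, hmin.1, fun b hb => ?_, Or.inl hmin.2⟩
      · rcases lt_trichotomy j (s.min' hs) with hlt | heq | hlt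
        · exact hlt
        · exact absurd (heq ▸ hx) hmin.2
        · exact absurd (hi_lt _ hlt) hmin.2
      · by_contra hb0
        exact absurd (s.min'_le b (by simpa [s] using ⟨hb.le.trans hmin.1, hb0⟩)) (not_le.mpr hb)
    · push Not at hex
      exact ⟨κ, hjκ, le_rfl, fun b hb => hex b hb.le, Or.inr rfl⟩
  obtain ⟨k, hik, hjk, hkc, hkmin⟩ : ∃ k : Fin n, i < k ∧ j < w k ∧ w k ≤ c₀ ∧
      ∀ r, i < r → r < k → ¬ (j < w r ∧ w r ≤ c₀) := by
    let s := Finset.univ.filter fun r => i < r ∧ j < w r ∧ w r ≤ c₀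
    have hs : s.Nonempty := by
      refine ⟨w.symm c₀, ?_⟩
      simp only [s, Finset.mem_filter, Finset.mem_univ, true_and, Equiv.apply_symm_apply, le_refl,
        and_true]
      refine ⟨?_, hjc₀⟩
      by_contra hle
      rcases (not_lt.mp hle).lt_or_eq with hlt | heq
      · have := hsmall _ hlt
        rw [Equiv.apply_symm_apply] at this
        exact absurd hc₀κ (not_le.mpr this)
      · rw [← heq, Equiv.apply_symm_apply] at hj
        exact hjc₀.ne' hj
    have hmin := s.min'_mem hs
    simp only [s, Finset.mem_filter, Finset.mem_univ, true_and] at hmin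
    refine ⟨s.min' hs, hmin.1, hmin.2.1, hmin.2.2, fun r hir hrk hr => ?_⟩
    exact absurd (s.min'_le r (by simpa [s] using ⟨hir, hr⟩)) (not_le.mpr hrk)
  refine ⟨k, ⟨hik, hj ▸ hjk, fun r hir hrk hr => hkmin r hir hrk
    ⟨hj ▸ hr.1, hr.2.le.trans hkc⟩⟩, ?_⟩
  set w' := w * Equiv.swap i k with hw'
  have hw'i : w' i = w k := by simp [hw']
  have hw'k : w' k = j := by simp [hw', hj]
  have hw'a : ∀ a, a ≠ i → a ≠ k → w' a = w a := fun a h1 h2 => by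
    simp [hw', Equiv.swap_apply_of_ne_of_ne h1 h2]
  intro r c A hA hcard
  by_cases hreg : i ≤ r ∧ r < k ∧ j ≤ c ∧ c < w k
  swap
  · refine h r c A hA (lt_of_le_of_lt ?_ hcard)
    refine Finset.card_le_card_of_injOn
      (fun a => if a = i ∧ ¬ w k ≤ c then k else if a = k ∧ ¬ w k ≤ c then i else a) ?_ ?_
    · intro a ha
      simp only [Finset.coe_filter, Finset.mem_univ, true_and, Set.mem_ofPred_eq] at ha ⊢
      by_cases hai : a = i
      · subst hai
        by_cases hc : w k ≤ c
        · simpa [hc, hw'i] using ha.1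
        · have : k ≤ r := by
            by_contra hkr
            exact hreg ⟨ha.1, not_le.mp hkr, hj ▸ ha.2, not_le.mp hc⟩
          simp only [hc, not_false_eq_true, and_self, if_true, hw'k]
          exact ⟨this, hj ▸ ha.2⟩
      · by_cases hak : a = k
        · subst hak
          simp only [hai, if_false, ha.2, not_true, and_false]
          exact ⟨ha.1, hw'k ▸ hjk.le.trans ha.2⟩
        · simpa [hai, hak, hw'a a hai hak] using ha
    · intro a ha b hb hab
      dsimp only at hab
      split_ifs at hab <;> grind
  · obtain ⟨hir, hrk, hjc, hck⟩ := hreg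
    have hcc₀ : c < c₀ := hck.trans_le hkc
    have hcκ : c ≤ κ := hcc₀.le.trans hc₀κ
    by_cases hAi : ∃ a ∈ A, a ≤ i
    · obtain ⟨a, ha, hai⟩ := hAi
      refine exists_dependency_of_zero_row ha fun b hb => ?_
      rcases hai.lt_or_eq with hlt | rfl
      · exact hrow a hlt b (hb.trans hcκ)
      · exact hc₀zero b (hb.trans_lt hcc₀)
    push Not at hAi
    have hiA : i ∉ A := fun hi => lt_irrefl _ (hAi i hi)
    have hrank : cornerRank w r c₀ ≤ cornerRank w' r c + 1 := by
      have : Finset.univ.filter (fun a => a ≤ r ∧ w a ≤ c₀) ⊆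
          insert i (Finset.univ.filter fun a => a ≤ r ∧ w' a ≤ c) := by
        intro a ha
        simp only [Finset.mem_filter, Finset.mem_univ, true_and, Finset.mem_insert] at ha ⊢
        by_cases hai : a = i
        · exact Or.inl hai
        refine Or.inr ⟨ha.1, ?_⟩
        have hak : a < k := ha.1.trans_lt hrk
        rw [hw'a a hai hak.ne]
        rcases lt_or_gt_of_ne hai with hlt | hgt
        · exact absurd (ha.2.trans hc₀κ) (not_le.mpr (hsmall a hlt))
        · by_contra hc
          exact hkmin a hgt hak ⟨hjc.trans_lt (not_le.mp hc), ha.2⟩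
      exact (Finset.card_le_card this).trans (Finset.card_insert_le _ _)
    rcases hc₀ with hc₀ | rfl
    · obtain ⟨γ, hγ0, hγA, hγ⟩ := h r c₀ (insert i A) (by
        intro a ha
        rcases Finset.mem_insert.mp ha with rfl | ha
        · exact hir
        · exact hA a ha) (by rw [Finset.card_insert_of_notMem hiA]; omega)
      refine ⟨fun a => if a = i then 0 else γ a, ?_, ?_, fun b hb => ?_⟩
      · intro h0
        have hne : ∀ a, a ≠ i → γ a = 0 := fun a ha => by simpa [ha] using congrFun h0 a
        have h1 := hγ c₀ le_rfl
        rw [Finset.sum_eq_single i (fun a _ ha => by simp [hne a ha]) (by simp)] at h1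
        apply hγ0
        ext a
        by_cases ha : a = i
        · rw [ha]; exact (mul_eq_zero.mp h1).resolve_right hc₀
        · exact hne a ha
      · intro a ha
        by_cases hai : a = i
        · simp [hai]
        · simpa [hai] using hγA a (by simp [hai, ha])
      · rw [← hγ b (hb.trans hcc₀.le)]
        refine Finset.sum_congr rfl fun a _ => ?_
        by_cases hai : a = i
        · simp [hai, hc₀zero b (hb.trans_lt hcc₀)]
        · simp [hai]
    · exfalso
      have hsub : A ⊆ Finset.univ.filter fun a => a ≤ r ∧ w' a ≤ c := by
        intro a ha
        have hia := hAi a ha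
        have har := hA a ha
        simp only [Finset.mem_filter, Finset.mem_univ, true_and]
        refine ⟨har, ?_⟩
        rw [hw'a a hia.ne' (har.trans_lt hrk).ne]
        by_contra hc
        exact hkmin a hia (har.trans_lt hrk) ⟨hjc.trans_lt (not_le.mp hc), hlarge a hia.le⟩
      exact absurd hcard (not_lt.mpr (Finset.card_le_card hsub))

end RankCondition

theorem exists_valuationSubring_of_generic_equation {ι κ E : Type} [Fintype κ] [Field E]
    {lam : ι → E} {μ : κ → E} (h : AlgebraicIndependent ℤ (Sum.elim μ lam)) {p : κ → E}
    (hp : ∑ l, μ l * p l = 0) {l₀ : κ} (hl₀ : p l₀ ≠ 0) :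
    ∃ (V : ValuationSubring E) (hV : ∀ i, lam i ∈ V) (F : Type) (_ : Field F) (φ : V →+* F),
      (∀ y, φ y = 0 ↔ ¬ IsUnit y) ∧ AlgebraicIndependent ℤ (fun i => φ ⟨lam i, hV i⟩) ∧
        ∃ l, p l / p l₀ ∉ V := by
  obtain ⟨hlam, hμ⟩ := AlgebraicIndependent.sumElim_iff.mp h
  let R := Algebra.adjoin ℤ (Set.range lam)
  let A := Subalgebra.algebraicClosure R E
  have hμA : AlgebraicIndependent A μ := hμ.subalgebraAlgebraicClosure
  have hex : ∃ l, p l / p l₀ ∉ A.toSubring := by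
    by_contra hall
    push Not at hall
    have hsum : ∑ l, (⟨p l / p l₀, hall l⟩ : A) • μ l = 0 := by
      have : ∀ l, (⟨p l / p l₀, hall l⟩ : A) • μ l = μ l * p l / p l₀ := fun l => by
        rw [Subalgebra.smul_def, smul_eq_mul]; ring
      simp_rw [this, ← Finset.sum_div, hp, zero_div]
    have h1 := Fintype.linearIndependent_iff.mp hμA.linearIndependent _ hsum l₀
    have h2 : p l₀ / p l₀ = 0 := congrArg Subtype.val h1
    rw [div_self hl₀] at h2
    exact one_ne_zero h2
  obtain ⟨l, hl⟩ := hex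
  have hclosed : IsIntegrallyClosedIn A.toSubring E := by
    rw [Subring.isIntegrallyClosedIn_iff]
    intro x hx
    have hx' : IsAlgebraic A x := IsIntegral.isAlgebraic (R := A) hx
    exact hx'.restrictScalars R
  obtain ⟨V, hAV, hlV⟩ := Subring.exists_le_valuationSubring_of_isIntegrallyClosedIn hl
  have hRA : ∀ y ∈ R, y ∈ A := fun y hy => isAlgebraic_algebraMap (⟨y, hy⟩ : R)
  have hV : ∀ i, lam i ∈ V := fun i =>
    hAV (hRA _ (Algebra.subset_adjoin (Set.mem_range_self i)))
  obtain ⟨F, _, φ, hφ⟩ : ∃ (F : Type) (_ : Field F) (φ : V →+* F), ∀ y, φ y = 0 ↔ ¬ IsUnit y :=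
    ⟨IsLocalRing.ResidueField V, inferInstance, IsLocalRing.residue V, fun y => by
      rw [IsLocalRing.residue_eq_zero_iff, IsLocalRing.mem_maximalIdeal, mem_nonunits_iff]⟩
  refine ⟨V, hV, F, inferInstance, φ, hφ, ?_, l, hlV⟩
  have hlift : AlgebraicIndependent ℤ (fun i => (⟨lam i, hV i⟩ : V)) :=
    AlgebraicIndependent.of_comp V.subtype.toIntAlgHom hlam
  have hmem : ∀ y ∈ Algebra.adjoin ℤ (Set.range fun i => (⟨lam i, hV i⟩ : V)), (y : E) ∈ R := by
    intro y hy
    induction hy using Algebra.adjoin_induction with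
    | mem y hy =>
      obtain ⟨i, rfl⟩ := hy
      exact Algebra.subset_adjoin (Set.mem_range_self i)
    | algebraMap r => simp
    | add a b _ _ ha hb => exact add_mem ha hb
    | mul a b _ _ ha hb => exact mul_mem ha hb
  refine hlift.map (f := φ.toIntAlgHom) fun y hy z hz hyz => ?_
  have hres : φ (y - z) = 0 := by
    rw [map_sub, sub_eq_zero]; exact hyz
  rw [hφ] at hres
  by_contra hne
  have hne' : ((y - z : V) : E) ≠ 0 := by
    rwa [Ne, ZeroMemClass.coe_eq_zero, sub_eq_zero]
  have hinv : ((y - z : V) : E)⁻¹ ∈ A :=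
    IsAlgebraic.inv (hRA _ (sub_mem (hmem y hy) (hmem z hz)))
  refine hres (IsUnit.of_mul_eq_one ⟨_, hAV hinv⟩ (Subtype.ext ?_))
  exact mul_inv_cancel₀ hne'

section HitsWith

variable {n : ℕ}

/-- The cell of the `n × n` grid indexed by the group `g` (a row or a column) and the position `l`
inside that group. -/
def cellOf : Fin n ⊕ Fin n → Fin n → Fin n × Fin n
  | Sum.inl i, l => (i, l)
  | Sum.inr j, l => (l, j)

/-- There is a tuple of nonzero vectors, one for each row and one for each column, whose
entrywise product satisfies the rank conditions of `w`, whose coordinates in `Z` vanish, and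
which satisfies `m g` generic linear equations in the group `g`. -/
def HitsWith (Z : Set ((Fin n ⊕ Fin n) × Fin n)) (w : Equiv.Perm (Fin n))
    (m : Fin n ⊕ Fin n → ℕ) : Prop :=
  ∃ (E : Type) (_ : Field E) (lam : Fin n ⊕ Fin n → ℕ → Option (Fin n) → E)
    (P : Fin n ⊕ Fin n → Option (Fin n) → E),
    AlgebraicIndependent ℤ
      (fun e : {e : (Fin n ⊕ Fin n) × ℕ // e.2 < m e.1} × Option (Fin n) =>
        lam e.1.1.1 e.1.1.2 e.2) ∧
    (∀ g, P g ≠ 0) ∧ (∀ g, ∀ k < m g, ∑ l, lam g k l * P g l = 0) ∧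
    (∀ g l, (g, l) ∈ Z → P g (some l) = 0) ∧
    RankCond w fun i j => P (Sum.inl i) (some j) * P (Sum.inr j) (some i)

variable {Z : Set ((Fin n ⊕ Fin n) × Fin n)} {w : Equiv.Perm (Fin n)} {m : Fin n ⊕ Fin n → ℕ}

/-- The index set of the equations of `HitsWith`, paired with the coordinates. -/
abbrev EquationCoord (m : Fin n ⊕ Fin n → ℕ) : Type :=
  {e : (Fin n ⊕ Fin n) × ℕ // e.2 < m e.1} × Option (Fin n)

theorem HitsWith.slice_of_le (h : HitsWith Z w m) (g : Fin n ⊕ Fin n) (l : Fin n)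
    {m' : Fin n ⊕ Fin n → ℕ} (hm'm : ∀ g', m' g' ≤ m g') (hm'g : m g = 0 ∨ m' g < m g) :
    HitsWith (insert (g, l) Z) w m' := by
  obtain ⟨E, _, lam, P, hlam, hP, heq, hZ, hrk⟩ := h
  let ψ : EquationCoord m' → EquationCoord m := fun e => (⟨e.1.1, e.1.2.trans_le (hm'm _)⟩, e.2)
  have hψ : Function.Injective ψ := fun a b hab => by
    simp only [ψ, Prod.mk.injEq, Subtype.mk.injEq, Subtype.val_inj] at hab
    exact Prod.ext hab.1 hab.2
  have hlam' : AlgebraicIndependent ℤ (fun e : EquationCoord m' => lam e.1.1.1 e.1.1.2 e.2) :=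
    hlam.comp ψ hψ
  rcases hm'g with hmg | hmg
  · refine ⟨E, inferInstance, lam, Function.update P g (fun o => o.elim 1 fun _ => 0), hlam',
      fun g' => ?_, fun g' k hk => ?_, fun g' l' hl' => ?_, ?_⟩
    · by_cases hg : g' = g
      · subst hg
        rw [Function.update_self]
        exact fun h => one_ne_zero (congrFun h none)
      · rw [Function.update_of_ne hg]; exact hP g'
    · have hk' := hk.trans_le (hm'm g')
      have hg : g' ≠ g := by rintro rfl; omega
      rw [Function.update_of_ne hg]; exact heq g' k hk'
    · by_cases hg : g' = g
      · subst hg; simp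
      · rw [Function.update_of_ne hg]
        refine hZ g' l' (hl'.resolve_left fun h => hg (congrArg Prod.fst h))
    · convert hrk.scale (fun a => if Sum.inl a = g then 0 else 1)
        (fun b => if Sum.inr b = g then 0 else 1) using 3 with i j
      by_cases h1 : Sum.inl i = g
      · subst h1; simp
      · by_cases h2 : Sum.inr j = g
        · subst h2; simp
        · simp [h1, h2]
  by_cases hl : P g (some l) = 0
  · refine ⟨E, inferInstance, lam, P, hlam', hP, fun g' k hk => heq g' k (hk.trans_le (hm'm g')),
      fun g' l' hl' => ?_, hrk⟩
    rcases hl' with hl' | hl'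
    · obtain ⟨rfl, rfl⟩ := Prod.mk.inj hl'; exact hl
    · exact hZ g' l' hl'
  have hsum : AlgebraicIndependent ℤ (Sum.elim (lam g (m' g))
      (fun e : EquationCoord m' => lam e.1.1.1 e.1.1.2 e.2)) := by
    have := hlam.comp (Sum.elim (fun o => (⟨(g, m' g), hmg⟩, o)) ψ) (by
      refine Function.Injective.sumElim (fun a b hab => (Prod.mk.inj hab).2) hψ ?_
      rintro a ⟨⟨⟨b1, b2⟩, hb⟩, b⟩ hab
      simp only [ψ, Prod.mk.injEq, Subtype.mk.injEq] at hab
      obtain ⟨⟨rfl, rfl⟩, -⟩ := hab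
      exact lt_irrefl _ hb)
    convert this using 1
    ext1 (a | a) <;> rfl
  obtain ⟨V, hV, F, _, φ, hφ, hind, l', hl'⟩ := exists_valuationSubring_of_generic_equation hsum
    (heq g (m' g) hmg) hl
  choose i hi0 hi using fun g' => V.exists_forall_div_mem (P g') (hP g')
  classical
  refine ⟨F, inferInstance,
    fun g' k o => if h : lam g' k o ∈ V then φ ⟨_, h⟩ else 0,
    fun g' o => φ ⟨_, hi g' o⟩, ?_, fun g' h => ?_, fun g' k hk => ?_,
    fun g' l'' hl'' => ?_, ?_⟩
  · convert hind using 2 with e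
    exact dif_pos (hV e)
  · have h1 := congrFun h (i g')
    have h2 : (⟨_, hi g' (i g')⟩ : V) = 1 := Subtype.ext (div_self (hi0 g'))
    beta_reduce at h1
    rw [h2, map_one] at h1
    exact one_ne_zero h1
  · have hmem : ∀ o, lam g' k o ∈ V := fun o => hV (⟨(g', k), hk⟩, o)
    have : ∑ o, (⟨_, hmem o⟩ : V) * ⟨_, hi g' o⟩ = 0 := by
      apply Subtype.ext
      have h1 := heq g' k (hk.trans_le (hm'm g'))
      push_cast
      simp only [mul_div_assoc', ← Finset.sum_div, h1, zero_div]
    simp only [hmem, dif_pos, ← map_mul, ← map_sum, this, map_zero]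
  · beta_reduce
    rcases hl'' with hl'' | hl''
    · obtain ⟨rfl, rfl⟩ := Prod.mk.inj hl''
      rw [hφ]
      intro hunit
      obtain ⟨b, hb⟩ := hunit.exists_right_inv
      apply hl'
      have hb' : P g' (some l'') / P g' (i g') * b = 1 := congrArg Subtype.val hb
      have : P g' l' / P g' (some l'') = P g' l' / P g' (i g') * b := by
        have := hi0 g'
        field_simp at hb' ⊢
        linear_combination (-P g' l') * hb'
      rw [this]
      exact mul_mem (hi g' l') b.2
    · have : (⟨_, hi g' (some l'')⟩ : V) = 0 := Subtype.ext (by simp [hZ g' l'' hl''])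
      rw [this, map_zero]
  · have := (hrk.scale (fun a => (P (Sum.inl a) (i (Sum.inl a)))⁻¹)
      (fun b => (P (Sum.inr b) (i (Sum.inr b)))⁻¹))
    have h2 : RankCond w fun a b =>
        (((⟨_, hi (Sum.inl a) (some b)⟩ : V) * ⟨_, hi (Sum.inr b) (some a)⟩ : V) : E) := by
      convert this using 3 with a b
      push_cast
      ring
    simpa only [map_mul] using h2.map_of_valuationSubring φ

theorem HitsWith.slice (h : HitsWith Z w m) (g : Fin n ⊕ Fin n) (l : Fin n) :
    HitsWith (insert (g, l) Z) w (fun g' => if g' = g then m g' - 1 else m g') :=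
  h.slice_of_le g l (fun g' => by split_ifs <;> omega) (by simp; omega)

end HitsWith

theorem HitsWith.le_ncard {n : ℕ} {Z : Set ((Fin n ⊕ Fin n) × Fin n)} {w : Equiv.Perm (Fin n)}
    {m : Fin n ⊕ Fin n → ℕ} (h : HitsWith Z w m) (g : Fin n ⊕ Fin n) :
    m g ≤ {l | (g, l) ∉ Z}.ncard := by
  obtain ⟨N, hN⟩ : ∃ N, N = {l | (g, l) ∉ Z}.ncard := ⟨_, rfl⟩
  rw [← hN]
  induction N generalizing Z m with
  | zero =>
    have hempty := (Set.ncard_eq_zero (Set.toFinite _)).mp hN.symm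
    obtain ⟨E, _, lam, P, hlam, hP, heq, hZ, -⟩ := h
    by_contra! hm
    have hP0 : ∀ l, P g (some l) = 0 := fun l => hZ g l <| by
      by_contra hl
      exact (Set.eq_empty_iff_forall_notMem.mp hempty l) hl
    have h1 := heq g 0 hm
    rw [Fintype.sum_option] at h1
    simp only [hP0, mul_zero, Finset.sum_const_zero, add_zero, mul_eq_zero] at h1
    rcases h1 with h1 | h1
    · exact hlam.ne_zero (⟨(g, 0), hm⟩, none) h1
    · exact hP g (funext fun o => by cases o with
        | none => exact h1
        | some l => exact hP0 l)
  | succ N ih =>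
    obtain ⟨l, hl⟩ := Set.nonempty_of_ncard_ne_zero (by omega : {l | (g, l) ∉ Z}.ncard ≠ 0)
    have h1 := ih (h.slice g l) ?_
    · beta_reduce at h1
      rw [if_pos rfl] at h1
      omega
    · have h2 : {l' | (g, l') ∉ insert (g, l) Z} = {l | (g, l) ∉ Z} \ {l} := by
        ext l'
        simp only [Set.mem_ofPred_eq, Set.mem_insert_iff, Prod.mk.injEq, true_and, not_or,
          Set.mem_sdiff, Set.mem_singleton_iff]
        tauto
      rw [h2, Set.ncard_sdiff_singleton_of_mem hl, ← hN]
      rfl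

section Mix

variable {n : ℕ}

/-- The entry in the cell `c` of the product of the matrix `L`, the permutation matrix of `w`,
and the matrix `U`. -/
def mixEntry {R : Type*} [CommRing R] (w : Equiv.Perm (Fin n)) (L U : Fin n → Fin n → R)
    (c : Fin n × Fin n) : R :=
  ∑ r, L c.1 r * U (w r) c.2

theorem map_mixEntry {R S : Type*} [CommRing R] [CommRing S] {F : Type*} [FunLike F R S]
    [RingHomClass F R S] (f : F)
    (w : Equiv.Perm (Fin n)) (L U : Fin n → Fin n → R) (c : Fin n × Fin n) :
    f (mixEntry w L U c) = mixEntry w (fun a r => f (L a r)) (fun a r => f (U a r)) c := by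
  simp [mixEntry]

theorem rankCond_mixEntry {E : Type*} [Field E] (w : Equiv.Perm (Fin n)) {L U : Fin n → Fin n → E}
    (hL : ∀ a r, a < r → L a r = 0) (hU : ∀ c b, b < c → U c b = 0) :
    RankCond w fun a b => mixEntry w L U (a, b) := by
  intro r c A hA hcard
  let T := Finset.univ.filter fun a => a ≤ r ∧ w a ≤ c
  let φ : (A → E) →ₗ[E] (T → E) := LinearMap.pi fun t =>
    ∑ a : A, L a t • LinearMap.proj a
  have hφ : LinearMap.ker φ ≠ ⊥ := LinearMap.ker_ne_bot_of_finrank_lt (by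
    rw [Module.finrank_pi, Module.finrank_pi, Fintype.card_coe, Fintype.card_coe]
    exact hcard)
  obtain ⟨γ, hγ, h0⟩ := (Submodule.ne_bot_iff _).mp hφ
  classical
  refine ⟨fun a => if h : a ∈ A then γ ⟨a, h⟩ else 0, ?_, fun a ha => dif_neg ha, fun b hb => ?_⟩
  · intro h
    apply h0
    ext a
    simpa using congrFun h a
  · have hsum : ∀ r', (∑ a, (if h : a ∈ A then γ ⟨a, h⟩ else 0) * L a r') * U (w r') b = 0 := by
      intro r'
      rcases lt_or_ge c (w r') with h1 | h1
      · rw [hU _ _ (hb.trans_lt h1), mul_zero]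
      rcases lt_or_ge r r' with h2 | h2
      · rw [Finset.sum_eq_zero, zero_mul]
        intro a _
        split_ifs with ha
        · rw [hL a r' ((hA a ha).trans_lt h2), mul_zero]
        · rw [zero_mul]
      · have h3 := congrFun (LinearMap.mem_ker.mp hγ) ⟨r', by simp [T, h1, h2]⟩
        simp only [φ, LinearMap.pi_apply, LinearMap.sum_apply, LinearMap.smul_apply,
          LinearMap.proj_apply, smul_eq_mul, Pi.zero_apply] at h3
        rw [← Finset.sum_subset (Finset.subset_univ A) (fun a _ ha => by simp [ha]),
          ← Finset.sum_coe_sort A]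
        simp only [Subtype.coe_eta, SetLike.coe_mem, dite_true]
        simp_rw [mul_comm (γ _)]
        rw [h3, zero_mul]
    simp only [mixEntry, Finset.mul_sum]
    rw [Finset.sum_comm]
    refine Finset.sum_eq_zero fun r' _ => ?_
    refine Eq.trans ?_ (hsum r')
    rw [Finset.sum_mul]
    exact Finset.sum_congr rfl fun _ _ => (mul_assoc _ _ _).symm

/-- The entries of the generic matrix `L * w * U` with `L` lower and `U` upper triangular. -/
noncomputable def genericEntry (k : Type*) [CommRing k] (w : Equiv.Perm (Fin n))
    (c : Fin n × Fin n) : MvPolynomial ((Fin n × Fin n) ⊕ (Fin n × Fin n)) k :=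
  mixEntry w (fun a r => if r ≤ a then X (Sum.inl (a, r)) else 0)
    (fun a r => if a ≤ r then X (Sum.inr (a, r)) else 0) c

theorem algebraicIndependent_genericEntry {k A : Type*} [CommRing k] [CommRing A] [Algebra k A]
    (w : Equiv.Perm (Fin n)) {L U : Fin n → Fin n → A}
    (hL : ∀ a r, a < r → L a r = 0) (hU : ∀ c b, b < c → U c b = 0) {C : Set (Fin n × Fin n)}
    (h : AlgebraicIndependent k fun c : C => mixEntry w L U c) :
    AlgebraicIndependent k fun c : C => genericEntry k w c := by
  refine AlgebraicIndependent.of_comp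
    (aeval (Sum.elim (fun c => L c.1 c.2) (fun c => U c.1 c.2)) : _ →ₐ[k] A) ?_
  convert h using 1
  ext1 c
  simp only [Function.comp, genericEntry, map_mixEntry]
  congr 1
  · ext a r
    split_ifs with h
    · simp
    · simp [hL a r (not_le.mp h)]
  · ext a r
    split_ifs with h
    · simp
    · simp [hU a r (not_le.mp h)]

theorem algebraicIndependent_genericEntry_rev (k : Type*) [CommRing k] {C : Set (Fin n × Fin n)}
    (hC : ∀ c ∈ C, n < (c.1 : ℕ) + c.2 + 2) :
    AlgebraicIndependent k fun c : C => genericEntry k (Fin.revPerm : Equiv.Perm (Fin n)) c := by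
  refine algebraicIndependent_genericEntry (A := MvPolynomial (Fin n × Fin n) k) Fin.revPerm
    (L := fun a r => if a = r then 1 else 0)
    (U := fun c b => if c ≤ b then X (c, b) else 0) (fun a r h => if_neg h.ne)
    (fun c b h => if_neg h.not_ge) ?_
  have := (algebraicIndependent_X (Fin n × Fin n) k).comp
    (fun c : C => (Fin.revPerm c.1.1, c.1.2)) (fun a b hab => by
      simp only [Prod.mk.injEq, EmbeddingLike.apply_eq_iff_eq] at hab
      exact Subtype.ext (Prod.ext hab.1 hab.2))
  convert this using 1
  ext1 c
  have h1 := hC c c.2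
  have h2 : Fin.rev c.1.1 ≤ c.1.2 := by
    rw [Fin.le_def, Fin.val_rev]
    omega
  rw [mixEntry, Finset.sum_eq_single c.1.1 (fun r _ hr => by rw [if_neg hr.symm, zero_mul])
    (fun h => absurd (Finset.mem_univ _) h)]
  simp [h2]

theorem mixEntry_swap {K : Type*} [Field K] (w : Equiv.Perm (Fin n)) {i k : Fin n} (hik : i ≠ k)
    {τ : K} (hτ : τ ≠ 0) (L U : Fin n → Fin n → K) (c : Fin n × Fin n) :
    mixEntry w
      (fun a r => if r = i then τ * L a i + L a k else if r = k then - τ⁻¹ * L a k else L a r)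
      (fun r b => if r = w i then U (w i) b + τ⁻¹ * U (w k) b else U r b) c =
    mixEntry (w * Equiv.swap i k) L U c + τ * L c.1 i * U (w i) c.2 := by
  unfold mixEntry
  rw [← Finset.add_sum_erase _ _ (Finset.mem_univ i),
    ← Finset.add_sum_erase _ _ (Finset.mem_erase.mpr ⟨hik.symm, Finset.mem_univ k⟩),
    ← Finset.add_sum_erase (Finset.univ : Finset (Fin n)) _ (Finset.mem_univ i),
    ← Finset.add_sum_erase _ _ (Finset.mem_erase.mpr ⟨hik.symm, Finset.mem_univ k⟩)]
  have : ∀ r ∈ (Finset.univ.erase i).erase k,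
      (if r = i then τ * L c.1 i + L c.1 k else if r = k then - τ⁻¹ * L c.1 k else L c.1 r) *
        (if w r = w i then U (w i) c.2 + τ⁻¹ * U (w k) c.2 else U (w r) c.2) =
      L c.1 r * U ((w * Equiv.swap i k) r) c.2 := by
    intro r hr
    simp only [Finset.mem_erase, Finset.mem_univ, and_true] at hr
    rw [if_neg hr.2, if_neg hr.1, if_neg (fun h => hr.2 (w.injective h)), Equiv.Perm.mul_apply,
      Equiv.swap_apply_of_ne_of_ne hr.2 hr.1]
  rw [Finset.sum_congr rfl this]
  simp only [if_true, hik.symm, if_false, EmbeddingLike.apply_eq_iff_eq, Equiv.Perm.mul_apply,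
    Equiv.swap_apply_left, Equiv.swap_apply_right]
  field_simp
  ring

theorem mixEntry_eq_zero {R : Type*} [CommRing R] (w : Equiv.Perm (Fin n)) {L U : Fin n → Fin n → R}
    (hL : ∀ a r, a < r → L a r = 0) (hU : ∀ c b, b < c → U c b = 0) {i j : Fin n}
    (h : ∀ r ≤ i, j < w r) : mixEntry w L U (i, j) = 0 := by
  refine Finset.sum_eq_zero fun r _ => ?_
  rcases le_or_gt r i with hr | hr
  · simp [hU _ _ (h r hr)]
  · simp [hL _ _ hr]

theorem algebraicIndependent_genericEntry_of_swap {k : Type} [Field k] (w : Equiv.Perm (Fin n))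
    {i l : Fin n} (hil : i < l) (hw : w i < w l) (hpre : ∀ r < i, w i < w r)
    {C : Set (Fin n × Fin n)}
    (h : AlgebraicIndependent k fun c : C => genericEntry k (w * Equiv.swap i l) c) :
    AlgebraicIndependent k fun c : ↥(insert (i, w i) C) => genericEntry k w c := by
  let S := MvPolynomial ((Fin n × Fin n) ⊕ (Fin n × Fin n)) k
  obtain ⟨L, hL, U, hU, hLi, hUi, hLU⟩ : ∃ (L : Fin n → Fin n → S) (_ : ∀ a r, a < r → L a r = 0)
      (U : Fin n → Fin n → S) (_ : ∀ c b, b < c → U c b = 0), L i i ≠ 0 ∧ U (w i) (w i) ≠ 0 ∧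
      AlgebraicIndependent k fun c : C => mixEntry (w * Equiv.swap i l) L U c :=
    ⟨_, fun a r h => if_neg h.not_ge, _, fun a r h => if_neg h.not_ge, by
      rw [if_pos le_rfl]; exact X_ne_zero _, by rw [if_pos le_rfl]; exact X_ne_zero _, h⟩
  obtain ⟨K, _, _, f, hf⟩ : ∃ (K : Type) (_ : Field K) (_ : Algebra k K)
      (f : Polynomial S →ₐ[k] K), Function.Injective f :=
    ⟨FractionRing (Polynomial S), inferInstance, inferInstance, IsScalarTower.toAlgHom k _ _,
      IsFractionRing.injective _ _⟩
  let b : Fin n × Fin n → Polynomial S := fun c =>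
    Polynomial.C (mixEntry (w * Equiv.swap i l) L U c) +
      Polynomial.X * Polynomial.C (L c.1 i * U (w i) c.2)
  have hτ : f Polynomial.X ≠ 0 := by
    rw [Ne, map_eq_zero_iff f hf]; exact Polynomial.X_ne_zero
  have hb : ∀ c, mixEntry w
      (fun a r => if r = i then f Polynomial.X * f (Polynomial.C (L a i)) + f (Polynomial.C (L a l))
        else if r = l then - (f Polynomial.X)⁻¹ * f (Polynomial.C (L a l))
          else f (Polynomial.C (L a r)))
      (fun r b => if r = w i then f (Polynomial.C (U (w i) b)) +
        (f Polynomial.X)⁻¹ * f (Polynomial.C (U (w l) b)) else f (Polynomial.C (U r b))) c =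
      f (b c) := by
    intro c
    rw [mixEntry_swap w hil.ne hτ (fun a r => f (Polynomial.C (L a r)))
      (fun a r => f (Polynomial.C (U a r))), map_add, map_mixEntry, map_mixEntry]
    simp only [map_mul, mul_assoc]
  refine algebraicIndependent_genericEntry w
    (L := fun a r => if r = i then f Polynomial.X * f (Polynomial.C (L a i)) +
          f (Polynomial.C (L a l))
        else if r = l then - (f Polynomial.X)⁻¹ * f (Polynomial.C (L a l))
          else f (Polynomial.C (L a r)))
    (U := fun r b => if r = w i then f (Polynomial.C (U (w i) b)) +
        (f Polynomial.X)⁻¹ * f (Polynomial.C (U (w l) b)) else f (Polynomial.C (U r b)))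
    (fun a r har => ?_) (fun r b hbr => ?_) ?_
  · split_ifs with h1 h2
    · subst h1; simp [hL _ _ har, hL _ _ (har.trans hil)]
    · subst h2; simp [hL _ _ har]
    · simp [hL _ _ har]
  · split_ifs with h1
    · subst h1; simp [hU _ _ hbr, hU _ _ (hbr.trans hw)]
    · simp [hU _ _ hbr]
  simp only [hb]
  have hij : b (i, w i) = Polynomial.X * Polynomial.C (L i i * U (w i) (w i)) := by
    simp only [b]
    rw [mixEntry_eq_zero _ hL hU, map_zero, zero_add]
    intro r hr
    rcases hr.lt_or_eq with hr | rfl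
    · rw [Equiv.Perm.mul_apply, Equiv.swap_apply_of_ne_of_ne hr.ne (hr.trans hil).ne]
      exact hpre r hr
    · simpa using hw
  let φ : Polynomial S →ₐ[k] S :=
    { Polynomial.evalRingHom 0 with
      commutes' := fun r => by
        rw [IsScalarTower.algebraMap_apply k S (Polynomial S)]
        simp }
  have hφ : ∀ y, φ y = y.eval 0 := fun y => rfl
  have key := AlgebraicIndependent.option_of_specialization φ (a := b (i, w i))
    (b := fun c : C => b c) (by
      rw [hij]
      exact mul_ne_zero Polynomial.X_ne_zero (by simpa using ⟨hLi, hUi⟩))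
    (by rw [hφ, hij]; simp) (by
      convert hLU using 1
      ext1 c
      simp only [Function.comp, hφ]
      simp [b])
  have key' := (key.map' (f := f) hf)
  classical
  have := key'.comp (fun c : ↥(insert (i, w i) C) =>
    if h : (c : Fin n × Fin n) ∈ C then some (⟨c, h⟩ : C) else none) (fun c d hcd => by
      obtain ⟨c, hc⟩ := c
      obtain ⟨d, hd⟩ := d
      rw [Subtype.mk.injEq]
      beta_reduce at hcd
      split_ifs at hcd with h1 h2 h2
      · simpa using hcd
      · rw [hc.resolve_right h1, hd.resolve_right h2])
  convert this using 1
  ext1 ⟨c, hc⟩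
  simp only [Function.comp]
  split_ifs with h1
  · rfl
  · rw [hc.resolve_right h1]; rfl

end Mix

section Construction

variable {n : ℕ}

theorem RankCond.map {E F : Type*} [Field E] [Field F] {w : Equiv.Perm (Fin n)}
    {x : Fin n → Fin n → E} (h : RankCond w x) (φ : E →+* F) :
    RankCond w fun a b => φ (x a b) := by
  intro r c A hA hcard
  obtain ⟨γ, h0, hγA, hγ⟩ := h r c A hA hcard
  refine ⟨fun a => φ (γ a), fun h => h0 (funext fun a => ?_), fun a ha => by simp [hγA a ha],
    fun b hb => ?_⟩
  · exact (map_eq_zero φ).mp (congrFun h a)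
  · simp only [← map_mul, ← map_sum, hγ b hb, map_zero]

theorem hitsWith_empty_of_algebraicIndependent_compl {K : Type} [Field K] {η : Fin n × Fin n → K}
    (hη : AlgebraicIndependent ℤ η) {w : Equiv.Perm (Fin n)} {B : Finset (Fin n × Fin n)}
    (hB : AlgebraicIndependent K fun c : {c // c ∉ B} => genericEntry K w c)
    {o : Fin n × Fin n → Fin n ⊕ Fin n}
    (ho : ∀ c ∈ B, o c = Sum.inl c.1 ∨ o c = Sum.inr c.2) :
    HitsWith ∅ w fun g =>
      (Finset.univ.filter fun l => ¬ (cellOf g l ∈ B ∧ o (cellOf g l) = g)).card := by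
  obtain ⟨E, _, _, f, hf⟩ : ∃ (E : Type) (_ : Field E) (_ : Algebra K E)
      (f : MvPolynomial ((Fin n × Fin n) ⊕ (Fin n × Fin n)) K →ₐ[K] E), Function.Injective f :=
    ⟨FractionRing (MvPolynomial ((Fin n × Fin n) ⊕ (Fin n × Fin n)) K), inferInstance,
      inferInstance, IsScalarTower.toAlgHom K _ _, IsFractionRing.injective _ _⟩
  let T : Fin n ⊕ Fin n → Finset (Fin n) := fun g =>
    Finset.univ.filter fun l => ¬ (cellOf g l ∈ B ∧ o (cellOf g l) = g)
  let ξ : Fin n × Fin n → E := fun c => f (genericEntry K w c)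
  have hrk : RankCond w fun a b => ξ (a, b) := by
    have := rankCond_mixEntry (E := E) w
      (L := fun a r => f (if r ≤ a then X (Sum.inl (a, r)) else 0))
      (U := fun a r => f (if a ≤ r then X (Sum.inr (a, r)) else 0))
      (fun a r h => by rw [if_neg h.not_ge, map_zero])
      (fun a r h => by rw [if_neg h.not_ge, map_zero])
    simpa only [ξ, genericEntry, map_mixEntry] using this
  have hη0 : ∀ c, algebraMap K E (η c) ≠ 0 := fun c => by simpa using hη.ne_zero c
  have hind : AlgebraicIndependent ℤ (Sum.elim
      (fun c : {c // c ∉ B} => algebraMap K E (η c)⁻¹ * ξ c) (algebraMap K E ∘ η)) :=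
    hη.sumElim_comp ((hB.map' (f := f) hf).units_smul (fun c => (η c)⁻¹)
      fun c => inv_ne_zero (hη.ne_zero _))
  let side : Fin n × Fin n → Fin n ⊕ Fin n := fun c =>
    if o c = Sum.inl c.1 then Sum.inr c.2 else Sum.inl c.1
  let val : Fin n ⊕ Fin n → Fin n → E := fun g l =>
    if g = side (cellOf g l) then algebraMap K E (η (cellOf g l))
    else algebraMap K E (η (cellOf g l))⁻¹ * ξ (cellOf g l)
  have hval : ∀ i j, val (Sum.inl i) j * val (Sum.inr j) i = ξ (i, j) := by
    intro i j
    have := hη0 (i, j)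
    by_cases h : o (i, j) = Sum.inl i
    · simp only [val, cellOf, side, h, if_true, map_inv₀, reduceCtorEq, if_false]
      field_simp
    · simp only [val, cellOf, side, h, if_true, map_inv₀, reduceCtorEq, if_false]
      field_simp
  have hnotMem : ∀ g, ∀ l ∈ T g, g ≠ side (cellOf g l) → cellOf g l ∉ B := by
    intro g l hl hg hc
    have hl' : ¬ (cellOf g l ∈ B ∧ o (cellOf g l) = g) := (Finset.mem_filter.mp hl).2
    refine hl' ⟨hc, ?_⟩
    have h1 := ho _ hc
    rcases g with i | j
    · by_contra h2
      exact hg (by simp only [side]; exact (if_neg h2).symm)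
    · by_contra h2
      exact hg (by simp only [side]; exact (if_pos (h1.resolve_right h2)).symm)
  let ι := {e : (Fin n ⊕ Fin n) × ℕ // e.2 < (T e.1).card}
  let t : ι → Fin n := fun e => (T e.1.1).orderEmbOfFin rfl ⟨e.1.2, e.2⟩
  have ht : ∀ e, t e ∈ T e.1.1 := fun e => Finset.orderEmbOfFin_mem _ _ _
  have htinj : ∀ e e' : ι, e.1.1 = e'.1.1 → t e = t e' → e = e' := by
    rintro ⟨⟨g, k⟩, h⟩ ⟨⟨g', k'⟩, h'⟩ hgg htt
    dsimp only at hgg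
    subst hgg
    have := ((T g).orderEmbOfFin rfl).injective htt
    exact Subtype.ext (Prod.ext rfl (Fin.mk.inj this))
  have hinj : ∀ g l g' l', cellOf g l = cellOf g' l' →
      (g = side (cellOf g l) ↔ g' = side (cellOf g' l')) → g = g' ∧ l = l' := by
    rintro (i | i) l (i' | i') l' h1 h2 <;> simp only [cellOf, Prod.mk.injEq] at h1 <;>
      obtain ⟨rfl, rfl⟩ := h1
    · exact ⟨rfl, rfl⟩
    · by_cases h : o (i, l) = Sum.inl i <;> simp [side, cellOf, h] at h2
    · by_cases h : o (l, i) = Sum.inl l <;> simp [side, cellOf, h] at h2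
    · exact ⟨rfl, rfl⟩
  have hvalt : AlgebraicIndependent ℤ fun e : ι => val e.1.1 (t e) := by
    have := hind.comp (fun e : ι => if h : e.1.1 = side (cellOf e.1.1 (t e)) then
        Sum.inr (cellOf e.1.1 (t e)) else Sum.inl ⟨_, hnotMem _ _ (ht e) h⟩) (by
      intro e e' hee
      have hcell : cellOf e.1.1 (t e) = cellOf e'.1.1 (t e') ∧
          (e.1.1 = side (cellOf e.1.1 (t e)) ↔ e'.1.1 = side (cellOf e'.1.1 (t e'))) := by
        beta_reduce at hee
        split_ifs at hee with h1 h2 h2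
        · exact ⟨Sum.inr.inj hee, iff_of_true h1 h2⟩
        · exact ⟨congrArg Subtype.val (Sum.inl.inj hee), iff_of_false h1 h2⟩
      obtain ⟨h1, h2⟩ := hinj _ _ _ _ hcell.1 hcell.2
      exact htinj e e' h1 h2)
    convert this using 1
    ext1 e
    simp only [Function.comp, val]
    split_ifs <;> rfl
  obtain ⟨F, _, φ, lam, hlam⟩ := exists_algebraicIndependent_coeffs_and_values
    (fun e : ι => val e.1.1) t hvalt
  refine ⟨F, inferInstance, fun g k l => if h : k < (T g).card then
      l.elim (∑ l, lam ⟨(g, k), h⟩ l * φ (val g l)) (lam ⟨(g, k), h⟩) else 0,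
    fun g l => l.elim (-1) fun l => φ (val g l), ?_, fun g h => ?_, fun g k hk => ?_,
    fun g l h => h.elim, ?_⟩
  · have := hlam.comp (fun e : ι × Option (Fin n) =>
      e.2.elim (Sum.inr e.1) fun l => Sum.inl (e.1, l))
      (by
        rintro ⟨e, _ | l⟩ ⟨e', _ | l'⟩ h <;> simp at h ⊢ <;> exact h)
    convert this using 1
    ext1 ⟨⟨⟨g, k⟩, hk⟩, l⟩
    beta_reduce
    rw [dif_pos hk]
    cases l <;> rfl
  · simpa using congrFun h none
  · beta_reduce
    rw [Fintype.sum_option]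
    simp
  · have := hrk.map φ
    simp only [← hval, map_mul] at this
    exact this

end Construction

section Family

variable {n : ℕ}

/-- The family of double Schubert polynomials, reindexed by inverse permutations and with the signs
of the column variables changed. -/
structure IsPositiveFamily (P : Equiv.Perm (Fin n) → MvPolynomial (Fin n ⊕ Fin n) ℤ) : Prop where
  rev : P Fin.revPerm =
    ∏ q ∈ Finset.univ.filter (fun q : Fin n × Fin n => (q.1 : ℕ) + (q.2 : ℕ) + 2 ≤ n),
      (X (Sum.inl q.1) + X (Sum.inr q.2))
  descent : ∀ (w : Equiv.Perm (Fin n)) (a b : Fin n), (b : ℕ) = a + 1 → w b < w a →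
    (X (Sum.inl a) - X (Sum.inl b)) * P (w * Equiv.swap a b) =
      P w - rename (Sum.map (Equiv.swap a b) id) (P w)

theorem permLength_swap_mul (π : Equiv.Perm (Fin n)) {a b : Fin n} (hb : (b : ℕ) = a + 1)
    (h : π⁻¹ b < π⁻¹ a) : permLength (Equiv.swap a b * π) + 1 = permLength π := by
  have hmem : (π⁻¹ b, π⁻¹ a) ∈ Finset.univ.filter
      (fun q : Fin n × Fin n => q.1 < q.2 ∧ π q.2 < π q.1) := by
    rw [Finset.mem_filter]
    exact ⟨Finset.mem_univ _, h, by
      rw [show π (π⁻¹ b) = b from π.apply_symm_apply b,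
        show π (π⁻¹ a) = a from π.apply_symm_apply a, Fin.lt_def]
      omega⟩
  unfold permLength
  rw [← Finset.card_erase_add_one hmem]
  congr 2
  ext ⟨x, y⟩
  obtain ⟨x, rfl⟩ := π⁻¹.surjective x
  obtain ⟨y, rfl⟩ := π⁻¹.surjective y
  have happ : ∀ x, π (π⁻¹ x) = x := π.apply_symm_apply
  rw [Finset.mem_erase, Finset.mem_filter, Finset.mem_filter]
  simp only [Finset.mem_univ, true_and, Equiv.Perm.mul_apply, happ, Ne, Prod.mk.injEq,
    EmbeddingLike.apply_eq_iff_eq]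
  by_cases hxa : x = a
  · subst hxa
    by_cases hyb : y = b
    · subst hyb
      exact iff_of_false (fun h' => h.not_gt h'.1) (fun h' => h.not_gt h'.2.1)
    · by_cases hyx : y = x
      · subst hyx; simp
      · rw [Equiv.swap_apply_left, Equiv.swap_apply_of_ne_of_ne hyx hyb]
        simp only [Fin.lt_def, Fin.ext_iff] at *
        omega
  · by_cases hxb : x = b
    · subst hxb
      by_cases hya : y = a
      · subst hya
        refine iff_of_false (fun h' => ?_) (fun h' => h'.1 ⟨rfl, rfl⟩)
        rw [Equiv.swap_apply_left, Equiv.swap_apply_right, Fin.lt_def] at h'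
        omega
      · by_cases hyx : y = x
        · subst hyx; simp
        · rw [Equiv.swap_apply_right, Equiv.swap_apply_of_ne_of_ne hya hyx]
          simp only [Fin.lt_def, Fin.ext_iff] at *
          omega
    · rw [Equiv.swap_apply_of_ne_of_ne hxa hxb]
      by_cases hya : y = a
      · subst hya
        rw [Equiv.swap_apply_left]
        simp only [Fin.lt_def, Fin.ext_iff] at *
        omega
      · by_cases hyb : y = b
        · subst hyb
          rw [Equiv.swap_apply_right]
          simp only [Fin.lt_def, Fin.ext_iff] at *
          omega
        · rw [Equiv.swap_apply_of_ne_of_ne hya hyb]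
          tauto

theorem permLength_le (π : Equiv.Perm (Fin n)) : permLength π ≤ n * n := by
  refine (Finset.card_filter_le _ _).trans ?_
  simp

theorem IsDoubleSchubertFamily.isPositiveFamily
    {𝔖 : Equiv.Perm (Fin n) → MvPolynomial (Fin n ⊕ Fin n) ℤ} (h : IsDoubleSchubertFamily n 𝔖) :
    IsPositiveFamily fun w => aeval (Sum.elim (fun i => X (Sum.inl i)) fun j => - X (Sum.inr j) :
      Fin n ⊕ Fin n → MvPolynomial (Fin n ⊕ Fin n) ℤ) (𝔖 w⁻¹) := by
  constructor
  · have : (Fin.revPerm : Equiv.Perm (Fin n))⁻¹ = Fin.revPerm := rfl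
    rw [this, h.1, map_prod]
    simp
  · intro w a b hb hw
    have hb' : b = ⟨(a : ℕ) + 1, hb ▸ b.2⟩ := Fin.ext hb
    have h1 := h.2 w⁻¹ a (hb ▸ b.2) (by
      rw [← hb']
      have := permLength_swap_mul w⁻¹ hb (by simpa using hw)
      omega)
    rw [← hb'] at h1
    have h2 := congrArg (aeval (Sum.elim (fun i => X (Sum.inl i)) fun j => - X (Sum.inr j) :
      Fin n ⊕ Fin n → MvPolynomial (Fin n ⊕ Fin n) ℤ)) h1
    simp only [map_mul, map_sub, aeval_X, Sum.elim_inl] at h2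
    rw [mul_inv_rev, Equiv.swap_inv, h2, aeval_rename]
    congr 1
    rw [← AlgHom.comp_apply]
    congr 1
    ext1 (i | i) <;> simp

end Family

section AscentInduction

variable {n : ℕ}

theorem Equiv.Perm.ascent_induction {motive : Equiv.Perm (Fin n) → Prop}
    (h : ∀ w, (∀ a b : Fin n, (b : ℕ) = a + 1 → w a < w b → motive (w * Equiv.swap a b)) → motive w)
    (w : Equiv.Perm (Fin n)) : motive w := by
  obtain ⟨N, hN⟩ : ∃ N, N = n * n - permLength w⁻¹ := ⟨_, rfl⟩
  induction N using Nat.strong_induction_on generalizing w with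
  | _ N ih =>
    refine h w fun a b hb hab => ih _ ?_ _ rfl
    have h1 := permLength_swap_mul (w * Equiv.swap a b)⁻¹ hb (by simpa using hab)
    rw [mul_inv_rev, ← mul_assoc, Equiv.swap_inv, Equiv.swap_mul_self, one_mul] at h1
    have h2 := permLength_le (Equiv.swap a b * w⁻¹)
    rw [mul_inv_rev, Equiv.swap_inv]
    omega

theorem apply_add_eq_of_forall_lt {w : Equiv.Perm (Fin n)} {i : Fin n}
    (hw : ∀ r < i, (w r : ℕ) + r + 1 = n) (h : ∀ r > i, w r < w i) : (w i : ℕ) + i + 1 = n := by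
  have hi := i.2
  obtain ⟨r, hr⟩ := w.surjective ⟨n - 1 - i, by omega⟩
  have hr' : (w r : ℕ) = n - 1 - i := congrArg Fin.val hr
  rcases lt_trichotomy r i with hri | rfl | hri
  · have := hw r hri
    rw [Fin.lt_def] at hri
    omega
  · omega
  · have h1 := h r hri
    have h2 := apply_add_lt_of_initial hw le_rfl
    rw [Fin.lt_def] at h1
    omega

theorem apply_lt_apply_of_forall_descent {w : Equiv.Perm (Fin n)} {i : Fin n}
    (h : ∀ a b : Fin n, i ≤ a → (b : ℕ) = a + 1 → w b < w a) {a b : Fin n} (ha : i ≤ a)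
    (hab : a < b) : w b < w a := by
  obtain ⟨d, hd⟩ : ∃ d, (b : ℕ) = a + 1 + d := ⟨b - (a + 1), by rw [Fin.lt_def] at hab; omega⟩
  induction d generalizing b with
  | zero => exact h a b ha hd
  | succ d ih =>
    have hb := b.2
    have h1 := ih (b := ⟨a + 1 + d, by omega⟩) (by rw [Fin.lt_def]; dsimp; omega) rfl
    exact (h _ b (by rw [Fin.le_def] at ha ⊢; dsimp; omega) (by rw [hd]; dsimp; omega)).trans h1

theorem eq_revPerm_of_initial_of_descent {w : Equiv.Perm (Fin n)} {i : Fin n}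
    (hw : ∀ r < i, (w r : ℕ) + r + 1 = n)
    (h : ∀ a b : Fin n, i ≤ a → (b : ℕ) = a + 1 → w b < w a) : w = Fin.revPerm := by
  have key : ∀ N : ℕ, ∀ r : Fin n, (r : ℕ) = N → (w r : ℕ) + r + 1 = n := by
    intro N
    induction N using Nat.strong_induction_on with
    | _ N ih =>
      rintro r rfl
      rcases lt_or_ge r i with hr | hr
      · exact hw r hr
      · exact apply_add_eq_of_forall_lt (fun r' hr' => ih r' hr' r' rfl)
          fun r' hr' => apply_lt_apply_of_forall_descent h hr hr'
  ext r
  have := key r r rfl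
  rw [Fin.revPerm_apply, Fin.val_rev]
  omega

variable {P : Equiv.Perm (Fin n) → MvPolynomial (Fin n ⊕ Fin n) ℤ}

theorem X_inl_sub_X_inl_ne_zero {a b : Fin n} (h : a ≠ b) :
    (X (Sum.inl a) - X (Sum.inl b) : MvPolynomial (Fin n ⊕ Fin n) ℤ) ≠ 0 := by
  rw [sub_ne_zero]
  exact fun h' => h (Sum.inl_injective (X_injective h'))

theorem IsPositiveFamily.ascent (hP : IsPositiveFamily P) {w : Equiv.Perm (Fin n)} {a b : Fin n}
    (hb : (b : ℕ) = a + 1) (h : w a < w b) :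
    (X (Sum.inl a) - X (Sum.inl b)) * P w =
      P (w * Equiv.swap a b) -
        rename (Sum.map (Equiv.swap a b) id) (P (w * Equiv.swap a b)) := by
  have := hP.descent (w * Equiv.swap a b) a b hb (by simpa using h)
  rwa [mul_assoc, Equiv.swap_mul_self, mul_one] at this

theorem rename_swap_rename_swap (a b : Fin n) (f : MvPolynomial (Fin n ⊕ Fin n) ℤ) :
    rename (Sum.map (Equiv.swap a b) id) (rename (Sum.map (Equiv.swap a b) id) f) = f := by
  rw [rename_rename]
  convert rename_id_apply f
  ext1 (i | i) <;> simp

theorem IsPositiveFamily.rename_eq_self (hP : IsPositiveFamily P) {w : Equiv.Perm (Fin n)}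
    {a b : Fin n} (hb : (b : ℕ) = a + 1) (h : w a < w b) :
    rename (Sum.map (Equiv.swap a b) id) (P w) = P w := by
  have h1 := hP.ascent hb h
  have h2 := congrArg (rename (Sum.map (Equiv.swap a b) id)) h1
  rw [map_mul, map_sub, map_sub, rename_swap_rename_swap, rename_X, rename_X] at h2
  simp only [Sum.map_inl, Equiv.swap_apply_left, Equiv.swap_apply_right] at h2
  have hab : a ≠ b := fun h => by rw [h] at hb; omega
  refine mul_left_cancel₀ (X_inl_sub_X_inl_ne_zero hab) ?_
  linear_combination -h1 - h2

theorem MvPolynomial.IsHomogeneous.exists_of_mul {σ : Type*} {f g : MvPolynomial σ ℤ} {d e : ℕ}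
    (hf : f.IsHomogeneous e) (hf0 : f ≠ 0) (h : (f * g).IsHomogeneous d) :
    ∃ d', g.IsHomogeneous d' := by
  have hcomp : ∀ k, homogeneousComponent (k + e) (f * g) = f * homogeneousComponent k g := by
    intro k
    let _ := MvPolynomial.gradedAlgebra (σ := σ) (R := ℤ)
    have he : ∀ (φ : MvPolynomial σ ℤ) i, (DirectSum.decompose (homogeneousSubmodule σ ℤ) φ i :
        MvPolynomial σ ℤ) = homogeneousComponent i φ := decomposition.decompose'_apply
    have := DirectSum.coe_decompose_mul_of_left_mem_of_le (homogeneousSubmodule σ ℤ) (b := g) hf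
      (Nat.le_add_left e k)
    rwa [Nat.add_sub_cancel, he, he] at this
  refine ⟨d - e, ?_⟩
  have hz : ∀ k, k ≠ d - e → homogeneousComponent k g = 0 := by
    intro k hk
    have h1 := hcomp k
    rw [homogeneousComponent_of_mem h, if_neg (by omega)] at h1
    exact (mul_eq_zero.mp h1.symm).resolve_left hf0
  have hsum := sum_homogeneousComponent g
  rw [← hsum]
  refine IsHomogeneous.sum _ _ _ fun k _ => ?_
  by_cases hk : k = d - e
  · rw [← hk]; exact homogeneousComponent_isHomogeneous k g
  · rw [hz k hk]; exact isHomogeneous_zero _ _ _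

theorem IsPositiveFamily.exists_isHomogeneous (hP : IsPositiveFamily P) (w : Equiv.Perm (Fin n)) :
    ∃ d, (P w).IsHomogeneous d := by
  induction w using Equiv.Perm.ascent_induction with
  | h w ih =>
    by_cases h : ∃ a b : Fin n, (b : ℕ) = a + 1 ∧ w a < w b
    · obtain ⟨a, b, hb, hab⟩ := h
      obtain ⟨d, hd⟩ := ih a b hb hab
      have hne : a ≠ b := fun h => by rw [h] at hb; omega
      refine IsHomogeneous.exists_of_mul ((isHomogeneous_X ℤ (Sum.inl a)).sub
        (isHomogeneous_X ℤ (Sum.inl b))) (X_inl_sub_X_inl_ne_zero hne) (d := d) ?_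
      rw [hP.ascent hb hab]
      exact hd.sub hd.rename_isHomogeneous
    · push Not at h
      have hrev : w = Fin.revPerm := by
        rcases n with _ | n
        · exact Subsingleton.elim _ _
        · refine eq_revPerm_of_initial_of_descent (i := 0)
            (fun r hr => absurd hr (Fin.not_lt_zero r))
            fun a b _ hb => (h a b hb).lt_of_ne fun h' => ?_
          rw [w.injective h'] at hb
          omega
      rw [hrev, hP.rev]
      exact ⟨_, IsHomogeneous.prod _ _ (fun _ => 1) fun q _ =>
        (isHomogeneous_X _ _).add (isHomogeneous_X _ _)⟩

end AscentInduction

section Cotransition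

variable {n : ℕ} {P : Equiv.Perm (Fin n) → MvPolynomial (Fin n ⊕ Fin n) ℤ}

open Classical in
/-- The cotransition formula for `w` at the row `i`. -/
def Cotransition (P : Equiv.Perm (Fin n) → MvPolynomial (Fin n ⊕ Fin n) ℤ)
    (w : Equiv.Perm (Fin n)) (i : Fin n) : Prop :=
  (X (Sum.inl i) + X (Sum.inr (w i))) * P w =
    ∑ k, if IsCover w i k then P (w * Equiv.swap i k) else 0

theorem Equiv.Perm.mul_swap_mul_swap_mul_swap (w : Equiv.Perm (Fin n)) {i a b k : Fin n}
    (hia : i ≠ a) (hib : i ≠ b) :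
    w * Equiv.swap a b * Equiv.swap i k * Equiv.swap a b =
      w * Equiv.swap i (Equiv.swap a b k) := by
  have h := Equiv.swap_apply_of_ne_of_ne hia hib
  have := Equiv.mul_swap_eq_swap_mul (Equiv.swap a b) i k
  rw [h] at this
  rw [mul_assoc w, this, mul_assoc w, mul_assoc, Equiv.swap_mul_self, mul_one]

theorem isCover_mul_swap_iff {w : Equiv.Perm (Fin n)} {i a b : Fin n} (hb : (b : ℕ) = a + 1)
    (hi : i < a) (hab : w a < w b) (k : Fin n) :
    IsCover w i (Equiv.swap a b k) ↔
      IsCover (w * Equiv.swap a b) i k ∧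
        (w * Equiv.swap a b * Equiv.swap i k) b < (w * Equiv.swap a b * Equiv.swap i k) a := by
  have hlt : a < b := by rw [Fin.lt_def]; omega
  have hgap : ∀ r, a < r → r ≠ b → b < r := fun r h1 h2 => by
    rw [Fin.lt_def] at *; rw [Ne, Fin.ext_iff] at h2; omega
  have hgap' : ∀ r, r < b → r ≠ a → r < a := fun r h1 h2 => by
    rw [Fin.lt_def] at *; rw [Ne, Fin.ext_iff] at h2; omega
  have hua : (w * Equiv.swap a b) a = w b := by simp
  have hub : (w * Equiv.swap a b) b = w a := by simp
  have hur : ∀ r, r ≠ a → r ≠ b → (w * Equiv.swap a b) r = w r := fun r h1 h2 => by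
    rw [Equiv.Perm.mul_apply, Equiv.swap_apply_of_ne_of_ne h1 h2]
  have hui := hur i hi.ne (hi.trans hlt).ne
  unfold IsCover
  by_cases hka : k = a
  · subst hka
    rw [Equiv.swap_apply_left, Equiv.Perm.mul_apply _ (Equiv.swap i k) b,
      Equiv.Perm.mul_apply _ (Equiv.swap i k) k, Equiv.swap_apply_right,
      Equiv.swap_apply_of_ne_of_ne (hi.trans hlt).ne' hlt.ne', hui, hua, hub]
    constructor
    · rintro ⟨-, h2, h3⟩
      refine ⟨⟨hi, h2, fun r h4 h5 => ?_⟩, ?_⟩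
      · rw [hur r h5.ne (h5.trans hlt).ne]; exact h3 r h4 (h5.trans hlt)
      · have := h3 k hi hlt
        have hne : w k ≠ w i := fun h => hi.ne' (w.injective h)
        exact lt_of_le_of_ne (not_lt.mp fun h => this ⟨h, hab⟩) hne
    · rintro ⟨⟨-, h2, h3⟩, h4⟩
      refine ⟨hi.trans hlt, h2, fun r h5 h6 => ?_⟩
      by_cases hr : r = k
      · rw [hr]; exact fun h => h.1.not_gt h4
      · have := h3 r h5 (hgap' r h6 hr)
        rwa [hur r hr h6.ne] at this
  by_cases hkb : k = b
  · subst hkb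
    rw [Equiv.swap_apply_right, Equiv.Perm.mul_apply _ (Equiv.swap i k) k,
      Equiv.Perm.mul_apply _ (Equiv.swap i k) a, Equiv.swap_apply_right,
      Equiv.swap_apply_of_ne_of_ne hi.ne' hlt.ne, hui, hua, hub]
    constructor
    · rintro ⟨-, h2, h3⟩
      refine ⟨⟨hi.trans hlt, h2, fun r h4 h5 => ?_⟩, h2.trans hab⟩
      by_cases hr : r = a
      · rw [hr, hua]; exact fun h => h.2.not_gt hab
      · rw [hur r hr h5.ne]; exact h3 r h4 (hgap' r h5 hr)
    · rintro ⟨⟨-, h2, h3⟩, -⟩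
      refine ⟨hi, h2, fun r h5 h6 => ?_⟩
      have := h3 r h5 (h6.trans hlt)
      rwa [hur r h6.ne (h6.trans hlt).ne] at this
  rw [Equiv.swap_apply_of_ne_of_ne hka hkb, hui, hur k hka hkb,
    Equiv.Perm.mul_apply _ (Equiv.swap i k), Equiv.Perm.mul_apply _ (Equiv.swap i k),
    Equiv.swap_apply_of_ne_of_ne (hi.trans hlt).ne' (Ne.symm hkb),
    Equiv.swap_apply_of_ne_of_ne hi.ne' (Ne.symm hka), hua, hub, and_iff_left hab]
  refine and_congr_right fun _ => and_congr_right fun _ =>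
    ⟨fun h r h1 h2 => ?_, fun h r h1 h2 => ?_⟩
  · by_cases hra : r = a
    · subst hra; rw [hua]; exact h b (hi.trans hlt) (hgap k h2 hkb)
    · by_cases hrb : r = b
      · subst hrb; rw [hub]; exact h a hi (hlt.trans h2)
      · rw [hur r hra hrb]; exact h r h1 h2
  · by_cases hra : r = a
    · subst hra; rw [← hub]; exact h b (hi.trans hlt) (hgap k h2 hkb)
    · by_cases hrb : r = b
      · subst hrb; rw [← hua]; exact h a hi (hlt.trans h2)
      · rw [← hur r hra hrb]; exact h r h1 h2

theorem IsPositiveFamily.cotransition_of_ascent (hP : IsPositiveFamily P) {w : Equiv.Perm (Fin n)}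
    {i a b : Fin n} (hb : (b : ℕ) = a + 1) (hi : i < a) (hab : w a < w b)
    (h : Cotransition P (w * Equiv.swap a b) i) : Cotransition P w i := by
  classical
  have hia : i ≠ a := hi.ne
  have hib : i ≠ b := fun h => by rw [h, Fin.lt_def] at hi; omega
  have hne : a ≠ b := fun h => by rw [h] at hb; omega
  refine mul_left_cancel₀ (X_inl_sub_X_inl_ne_zero hne) ?_
  unfold Cotransition at h
  rw [Equiv.Perm.mul_apply, Equiv.swap_apply_of_ne_of_ne hia hib] at h
  have h2 := congrArg (rename (Sum.map (Equiv.swap a b) id)) h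
  rw [map_mul, map_add, rename_X, rename_X, map_sum] at h2
  simp only [Sum.map_inl, Sum.map_inr, id, Equiv.swap_apply_of_ne_of_ne hia hib] at h2
  calc _ = (X (Sum.inl i) + X (Sum.inr (w i))) * ((X (Sum.inl a) - X (Sum.inl b)) * P w) := by ring
    _ = _ := by
      rw [hP.ascent hb hab, mul_sub, h, h2, ← Finset.sum_sub_distrib, Finset.mul_sum,
        ← Equiv.sum_comp (Equiv.swap a b) fun k => (X (Sum.inl a) - X (Sum.inl b)) *
          if IsCover w i k then P (w * Equiv.swap i k) else 0]
      refine Finset.sum_congr rfl fun k _ => ?_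
      by_cases hk : IsCover (w * Equiv.swap a b) i k
      · rw [if_pos hk]
        set v := w * Equiv.swap a b * Equiv.swap i k with hv
        by_cases hdesc : v b < v a
        · rw [if_pos ((isCover_mul_swap_iff hb hi hab k).mpr ⟨hk, hdesc⟩),
            ← hP.descent v a b hb hdesc,
            hv, Equiv.Perm.mul_swap_mul_swap_mul_swap w hia hib]
        · rw [if_neg fun h => hdesc ((isCover_mul_swap_iff hb hi hab k).mp h).2,
            hP.rename_eq_self hb, sub_self, mul_zero]
          exact lt_of_le_of_ne (not_lt.mp hdesc) fun h => hne (v.injective h)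
      · rw [if_neg hk, if_neg fun h => hk ((isCover_mul_swap_iff hb hi hab k).mp h).1]
        simp

theorem IsPositiveFamily.cotransition_of_descending (hP : IsPositiveFamily P)
    {w : Equiv.Perm (Fin n)} {i b : Fin n} (hb : (b : ℕ) = i + 1)
    (hpre : ∀ r < i, (w r : ℕ) + r + 1 = n) (hi : (i : ℕ) + w i + 2 ≤ n)
    (hdesc : ∀ a c : Fin n, i < a → (c : ℕ) = a + 1 → w c < w a)
    (ih : w i < w b → (∀ r < b, ((w * Equiv.swap i b) r : ℕ) + r + 1 = n) →
      (b : ℕ) + (w * Equiv.swap i b) b + 2 ≤ n → Cotransition P (w * Equiv.swap i b) b) :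
    Cotransition P w i := by
  classical
  have hib : i < b := by rw [Fin.lt_def]; omega
  have hanti : ∀ r, b < r → w r < w b := fun r hr =>
    apply_lt_apply_of_forall_descent (i := b) (fun a c ha hc => hdesc a c (hib.trans_le ha) hc)
      le_rfl hr
  have hlt : w i < w b := by
    by_contra hge
    have h1 : ∀ r > i, w r < w i := by
      intro r hr
      have hbr : b ≤ r := by rw [Fin.le_def]; rw [gt_iff_lt, Fin.lt_def] at hr; omega
      rcases hbr.lt_or_eq with h | rfl
      · exact (hanti r h).trans_le (not_lt.mp hge)
      · exact lt_of_le_of_ne (not_lt.mp hge) fun h => hib.ne (w.injective h).symm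
    have := apply_add_eq_of_forall_lt hpre h1
    omega
  have hui : (w * Equiv.swap i b) i = w b := by simp
  have hub : (w * Equiv.swap i b) b = w i := by simp
  have hur : ∀ r, r ≠ i → r ≠ b → (w * Equiv.swap i b) r = w r := fun r h1 h2 => by
    rw [Equiv.Perm.mul_apply, Equiv.swap_apply_of_ne_of_ne h1 h2]
  have hupre : ∀ r < i, ((w * Equiv.swap i b) r : ℕ) + r + 1 = n := fun r hr => by
    rw [hur r hr.ne (hr.trans hib).ne]; exact hpre r hr
  have hwb : (w b : ℕ) + i + 1 = n := by
    have := apply_add_eq_of_forall_lt hupre fun r hr => by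
      rw [hui]
      by_cases h : r = b
      · rw [h, hub]; exact hlt
      · have hbr : b < r := lt_of_le_of_ne (by
          rw [Fin.le_def]; rw [gt_iff_lt, Fin.lt_def] at hr; omega) (Ne.symm h)
        rw [hur r hr.ne' h]; exact hanti r hbr
    rwa [hui] at this
  have hupre' : ∀ r < b, ((w * Equiv.swap i b) r : ℕ) + r + 1 = n := fun r hr => by
    rcases (show r ≤ i by rw [Fin.le_def]; rw [Fin.lt_def] at hr; omega).lt_or_eq with h | rfl
    · exact hupre r h
    · rw [hui]; exact hwb
  have hcover : ∀ k, IsCover w i k ↔ k = b ∨ IsCover (w * Equiv.swap i b) b k := by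
    intro k
    have hle : ∀ r, i < r → b ≤ r := fun r hr => by
      rw [Fin.le_def]; rw [Fin.lt_def] at hr; omega
    unfold IsCover
    constructor
    · rintro ⟨h1, h2, h3⟩
      refine or_iff_not_imp_left.mpr fun hkb => ?_
      have hbk := lt_of_le_of_ne (hle k h1) (Ne.symm hkb)
      rw [hub, hur k h1.ne' hkb]
      refine ⟨hbk, h2, fun r h4 h5 => ?_⟩
      rw [hur r (hib.trans h4).ne' h4.ne']
      exact h3 r (hib.trans h4) h5
    · rintro (rfl | ⟨h1, h2, h3⟩)
      · exact ⟨hib, hlt, fun r h4 h5 => absurd (hle r h4) h5.not_ge⟩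
      · rw [hub, hur k (hib.trans h1).ne' h1.ne'] at h2
        refine ⟨hib.trans h1, h2, fun r h4 h5 => ?_⟩
        rcases (hle r h4).lt_or_eq with h6 | rfl
        · have := h3 r h6 h5
          rwa [hub, hur k (hib.trans h1).ne' h1.ne', hur r h4.ne' h6.ne'] at this
        · exact fun h => h.2.not_gt (hanti k h1)
  have hmain := hP.ascent hb hlt
  have hsum : (∑ k, if IsCover w i k then P (w * Equiv.swap i k) else 0) =
      P (w * Equiv.swap i b) +
        ∑ k, if IsCover (w * Equiv.swap i b) b k then P (w * Equiv.swap i k) else 0 := by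
    rw [← Finset.add_sum_erase _ _ (Finset.mem_univ b), if_pos ((hcover b).mpr (Or.inl rfl)),
      ← Finset.add_sum_erase (Finset.univ : Finset (Fin n)) (fun k =>
        if IsCover (w * Equiv.swap i b) b k then P (w * Equiv.swap i k) else 0) (Finset.mem_univ b),
      if_neg fun h => lt_irrefl _ h.1, zero_add]
    congr 1
    refine Finset.sum_congr rfl fun k hk => if_congr ?_ rfl rfl
    rw [hcover, or_iff_right (Finset.ne_of_mem_erase hk)]
  refine mul_left_cancel₀ (X_inl_sub_X_inl_ne_zero hib.ne) ?_
  rw [hsum]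
  by_cases hcase : (b : ℕ) + w i + 2 ≤ n
  · have hco := ih hlt hupre' (by rwa [hub])
    unfold Cotransition at hco
    rw [hub] at hco
    have hco' := congrArg (rename (Sum.map (Equiv.swap i b) id)) hco
    rw [map_mul, map_add, rename_X, rename_X, map_sum] at hco'
    simp only [Sum.map_inl, Sum.map_inr, id, Equiv.swap_apply_right] at hco'
    have hterm : (X (Sum.inl i) - X (Sum.inl b)) *
        (∑ k, if IsCover (w * Equiv.swap i b) b k then P (w * Equiv.swap i k) else 0) =
        (X (Sum.inl b) + X (Sum.inr (w i))) * P (w * Equiv.swap i b) -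
          (X (Sum.inl i) + X (Sum.inr (w i))) *
            rename (Sum.map (Equiv.swap i b) id) (P (w * Equiv.swap i b)) := by
      rw [hco, hco', ← Finset.sum_sub_distrib, Finset.mul_sum]
      refine Finset.sum_congr rfl fun k _ => ?_
      by_cases hk : IsCover (w * Equiv.swap i b) b k
      · have hbk := hk.1
        rw [if_pos hk, if_pos hk, ← hP.descent _ i b hb]
        · congr 2
          have h := Equiv.mul_swap_eq_swap_mul (Equiv.swap i b) b k
          rw [Equiv.swap_apply_right,
            Equiv.swap_apply_of_ne_of_ne (hib.trans hbk).ne' hbk.ne'] at h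
          rw [mul_assoc w, h, mul_assoc w, mul_assoc, Equiv.swap_mul_self, mul_one]
        · rw [Equiv.Perm.mul_apply _ (Equiv.swap b k), Equiv.Perm.mul_apply _ (Equiv.swap b k),
            Equiv.swap_apply_left, Equiv.swap_apply_of_ne_of_ne hib.ne (hib.trans hbk).ne, hui,
            hur k (hib.trans hbk).ne' hbk.ne']
          exact hanti k hbk
      · rw [if_neg hk, if_neg hk, map_zero, mul_zero, sub_zero]
    rw [mul_add, hterm]
    linear_combination (X (Sum.inl i) + X (Sum.inr (w i))) * hmain
  · have hwi : (w i : ℕ) + b + 1 = n := by omega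
    have hrev : w * Equiv.swap i b = Fin.revPerm := by
      refine eq_revPerm_of_initial_of_descent hupre' fun a c hba hc => ?_
      have hac : a < c := by rw [Fin.lt_def]; omega
      rcases hba.lt_or_eq with h | rfl
      · rw [hur a (hib.trans h).ne' h.ne', hur c (hib.trans (h.trans hac)).ne' (h.trans hac).ne']
        exact hdesc a c (hib.trans h) hc
      · have h1 := apply_add_lt_of_initial hupre' hac.le
        refine lt_of_le_of_ne ?_ fun h => hac.ne' ((w * Equiv.swap i b).injective h)
        rw [hub, Fin.le_def]
        omega
    have hnone : ∀ k, ¬ IsCover (w * Equiv.swap i b) b k := fun k hk => by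
      have h1 := apply_add_lt_of_initial hupre' hk.1.le
      have h2 := hk.2.1
      rw [hub, Fin.lt_def] at h2
      omega
    simp only [hnone, if_false, Finset.sum_const_zero, add_zero]
    have hprod := hP.rev
    have hmem : (i, w i) ∈ Finset.univ.filter
        (fun q : Fin n × Fin n => (q.1 : ℕ) + (q.2 : ℕ) + 2 ≤ n) := by
      rw [Finset.mem_filter]; exact ⟨Finset.mem_univ _, hi⟩
    rw [← Finset.mul_prod_erase _ _ hmem] at hprod
    set S : MvPolynomial (Fin n ⊕ Fin n) ℤ := ∏ q ∈ (Finset.univ.filter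
      (fun q : Fin n × Fin n => (q.1 : ℕ) + (q.2 : ℕ) + 2 ≤ n)).erase (i, w i),
      (X (Sum.inl q.1) + X (Sum.inr q.2)) with hS
    have hsymm : rename (Sum.map (Equiv.swap i b) id) S = S := by
      rw [hS, map_prod]
      refine Finset.prod_equiv ((Equiv.swap i b).prodCongr (Equiv.refl _)) (fun q => ?_)
        fun q _ => by simp
      obtain ⟨r, c⟩ := q
      simp only [Finset.mem_erase, Finset.mem_filter, Finset.mem_univ, true_and, Ne, Prod.mk.injEq,
        Equiv.prodCongr_apply, Prod.map_apply, Equiv.refl_apply]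
      by_cases hri : r = i
      · rw [hri, Equiv.swap_apply_left]
        simp only [Fin.ext_iff, true_and]
        omega
      · by_cases hrb : r = b
        · rw [hrb, Equiv.swap_apply_right]
          simp only [Fin.ext_iff, true_and]
          omega
        · rw [Equiv.swap_apply_of_ne_of_ne hri hrb]
    rw [hrev, hprod, map_mul, hsymm, map_add, rename_X, rename_X] at hmain
    simp only [Sum.map_inl, Sum.map_inr, id, Equiv.swap_apply_left] at hmain
    rw [hrev, hprod]
    linear_combination (X (Sum.inl i) + X (Sum.inr (w i))) * hmain

theorem IsPositiveFamily.cotransition (hP : IsPositiveFamily P) {w : Equiv.Perm (Fin n)} {i : Fin n}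
    (hpre : ∀ r < i, (w r : ℕ) + r + 1 = n) (hi : (i : ℕ) + w i + 2 ≤ n) : Cotransition P w i := by
  induction w using Equiv.Perm.ascent_induction generalizing i with
  | h w ih =>
    by_cases h : ∃ a b : Fin n, (b : ℕ) = a + 1 ∧ i < a ∧ w a < w b
    · obtain ⟨a, b, hb, hia, hab⟩ := h
      have hib : i < b := hia.trans (by rw [Fin.lt_def]; omega)
      have hur : ∀ r ≤ i, (w * Equiv.swap a b) r = w r := fun r hr => by
        rw [Equiv.Perm.mul_apply,
          Equiv.swap_apply_of_ne_of_ne (hr.trans_lt hia).ne (hr.trans_lt hib).ne]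
      refine hP.cotransition_of_ascent hb hia hab (ih a b hb hab (fun r hr => ?_) ?_)
      · rw [hur r hr.le]; exact hpre r hr
      · rwa [hur i le_rfl]
    · push Not at h
      obtain ⟨b, hb⟩ : ∃ b : Fin n, (b : ℕ) = i + 1 := ⟨⟨i + 1, by omega⟩, rfl⟩
      refine hP.cotransition_of_descending hb hpre hi (fun a c ha hc => ?_)
        fun hlt hpre' hb' => ih i b hb hlt hpre' hb'
      refine (h a c hc ha).lt_of_ne fun h' => ?_
      rw [w.injective h'] at hc
      omega

end Cotransition

section Peeling

variable {n : ℕ}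

theorem cellOf_eq_iff {g : Fin n ⊕ Fin n} {l : Fin n} {c : Fin n × Fin n} :
    cellOf g l = c ↔ (g, l) = (Sum.inl c.1, c.2) ∨ (g, l) = (Sum.inr c.2, c.1) := by
  rcases g with i | j <;> simp [cellOf, Prod.ext_iff, and_comm]

/-- The number of cells of the group `g` outside `D`. -/
def freeCount (D : Finset (Fin n × Fin n)) (g : Fin n ⊕ Fin n) : ℕ :=
  (Finset.univ.filter fun l => cellOf g l ∉ D).card

theorem freeCount_insert {D : Finset (Fin n × Fin n)} {c : Fin n × Fin n} (hc : c ∉ D)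
    (g : Fin n ⊕ Fin n) :
    freeCount D g = freeCount (insert c D) g + (if g = Sum.inl c.1 then 1 else 0) +
      if g = Sum.inr c.2 then 1 else 0 := by
  have key : ∀ l₀, cellOf g l₀ = c → freeCount D g = freeCount (insert c D) g + 1 := by
    intro l₀ h0
    unfold freeCount
    rw [← Finset.card_erase_add_one (s := Finset.univ.filter fun l => cellOf g l ∉ D) (a := l₀)
      (by rw [Finset.mem_filter, h0]; exact ⟨Finset.mem_univ _, hc⟩)]
    congr 2
    ext l
    simp only [Finset.mem_erase, Finset.mem_filter, Finset.mem_univ, true_and, Finset.mem_insert,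
      not_or, ← h0]
    refine and_congr_left fun _ => not_congr ⟨fun h => by rw [h], fun h => ?_⟩
    rcases g with i | j
    · exact (Prod.mk.inj h).2
    · exact (Prod.mk.inj h).1
  obtain ⟨i, j⟩ := c
  rcases g with a | b
  · by_cases h : a = i
    · subst h; rw [key j rfl]; simp
    · have : ∀ l, cellOf (Sum.inl a) l ≠ (i, j) := fun l hl => h (Prod.mk.inj hl).1
      simp [freeCount, this, h]
  · by_cases h : b = j
    · subst h; rw [key i rfl]; simp
    · have : ∀ l, cellOf (Sum.inr b) l ≠ (i, j) := fun l hl => h (Prod.mk.inj hl).2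
      simp [freeCount, this, h]

/-- The coordinates of the cells in `D`. -/
def coordsOf (D : Finset (Fin n × Fin n)) : Set ((Fin n ⊕ Fin n) × Fin n) :=
  {x | cellOf x.1 x.2 ∈ D}

theorem coordsOf_insert (D : Finset (Fin n × Fin n)) (c : Fin n × Fin n) :
    coordsOf (insert c D) =
      insert (Sum.inl c.1, c.2) (insert (Sum.inr c.2, c.1) (coordsOf D)) := by
  ext ⟨g, l⟩
  simp only [coordsOf, Set.mem_ofPred_eq, Finset.mem_insert, Set.mem_insert_iff, cellOf_eq_iff,
    or_assoc]

/-- `Q` has nonnegative coefficients, its monomials come from oriented sets of cells with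
independent complement, and it satisfies every system of equations with a solution. -/
structure IsPeeled (k : Type) [Field k] (D : Finset (Fin n × Fin n)) (w : Equiv.Perm (Fin n))
    (Q : MvPolynomial (Fin n ⊕ Fin n) ℤ) : Prop where
  coeff_nonneg : ∀ ν, 0 ≤ Q.coeff ν
  exists_cells : ∀ ν ∈ Q.support, ∃ B : Finset (Fin n × Fin n), Disjoint B D ∧
    ∃ o : Fin n × Fin n → Fin n ⊕ Fin n, (∀ c ∈ B, o c = Sum.inl c.1 ∨ o c = Sum.inr c.2) ∧
      (∀ g, ν g = (B.filter fun c => o c = g).card) ∧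
      AlgebraicIndependent k fun c : {c | c ∉ B ∧ c ∉ D} => genericEntry k w c
  exists_mem_support : ∀ m, HitsWith (coordsOf D) w m →
    ∃ ν ∈ Q.support, ∀ g, m g + ν g ≤ freeCount D g

variable {k : Type} [Field k] {D : Finset (Fin n × Fin n)} {w : Equiv.Perm (Fin n)}

theorem MvPolynomial.mem_support_add_of_nonneg {σ : Type*} {f g : MvPolynomial σ ℤ}
    (hf : ∀ ν, 0 ≤ f.coeff ν) (hg : ∀ ν, 0 ≤ g.coeff ν) {ν : σ →₀ ℕ} :
    ν ∈ (f + g).support ↔ ν ∈ f.support ∨ ν ∈ g.support := by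
  have h1 := hf ν
  have h2 := hg ν
  simp only [mem_support_iff, coeff_add]
  omega

theorem MvPolynomial.coeff_X_mul_nonneg {σ : Type*} {f : MvPolynomial σ ℤ}
    (hf : ∀ ν, 0 ≤ f.coeff ν) (v : σ) (ν : σ →₀ ℕ) : 0 ≤ (X v * f).coeff ν := by
  classical
  rw [coeff_X_mul']
  split_ifs
  · exact hf _
  · exact le_rfl

theorem MvPolynomial.mem_support_X_mul {σ : Type*} {f : MvPolynomial σ ℤ} {v : σ} {ν : σ →₀ ℕ} :
    ν ∈ (X v * f).support ↔ ∃ ν' ∈ f.support, ν = Finsupp.single v 1 + ν' := by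
  rw [support_X_mul, Finset.mem_map]
  simp only [addLeftEmbedding_apply, eq_comm]

theorem IsPeeled.mul_X_add_X {c : Fin n × Fin n} (hc : c ∉ D)
    {Q : MvPolynomial (Fin n ⊕ Fin n) ℤ} (h : IsPeeled k (insert c D) w Q)
    (hw : ∀ a ≤ c.1, c.2 < w a) :
    IsPeeled k D w ((X (Sum.inl c.1) + X (Sum.inr c.2)) * Q) := by
  have hnn := coeff_X_mul_nonneg h.coeff_nonneg
  rw [add_mul]
  refine ⟨fun ν => by rw [coeff_add]; exact add_nonneg (hnn _ _) (hnn _ _), fun ν hν => ?_,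
    fun m hm => ?_⟩
  · obtain ⟨v, hv, ν', hν', rfl⟩ : ∃ v, (v = Sum.inl c.1 ∨ v = Sum.inr c.2) ∧ ∃ ν' ∈ Q.support,
        ν = Finsupp.single v 1 + ν' := by
      rcases (mem_support_add_of_nonneg (hnn _) (hnn _)).mp hν with hν | hν
      · exact ⟨_, Or.inl rfl, mem_support_X_mul.mp hν⟩
      · exact ⟨_, Or.inr rfl, mem_support_X_mul.mp hν⟩
    obtain ⟨B, hBD, o, ho, hνB, hind⟩ := h.exists_cells ν' hν'
    have hcB : c ∉ B := fun hcB => Finset.disjoint_left.mp hBD hcB (Finset.mem_insert_self _ _)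
    have hupd : ∀ c' ∈ B, Function.update o c v c' = o c' := fun c' hc' =>
      Function.update_of_ne (ne_of_mem_of_not_mem hc' hcB) _ _
    refine ⟨insert c B, ?_, Function.update o c v, fun c' hc' => ?_, fun g => ?_, ?_⟩
    · rw [Finset.disjoint_insert_left]
      exact ⟨hc, hBD.mono_right (Finset.subset_insert _ _)⟩
    · rcases Finset.mem_insert.mp hc' with rfl | hc'
      · rw [Function.update_self]; exact hv
      · rw [hupd c' hc']; exact ho c' hc'
    · have hfilter : (B.filter fun c' => Function.update o c v c' = g) =
          B.filter fun c' => o c' = g := Finset.filter_congr fun c' hc' => by rw [hupd c' hc']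
      rw [Finsupp.add_apply, hνB g, Finset.filter_insert, Function.update_self, hfilter,
        Finsupp.single_apply]
      split_ifs with hvg
      · rw [Finset.card_insert_of_notMem fun h => hcB (Finset.mem_filter.mp h).1, add_comm]
      · rw [zero_add]
    · have hset : {c' | c' ∉ insert c B ∧ c' ∉ D} = {c' | c' ∉ B ∧ c' ∉ insert c D} := by
        ext c'
        simp only [Set.mem_ofPred_eq, Finset.mem_insert]
        tauto
      rwa [hset]
  · obtain ⟨v, m', hm', hmm'⟩ : ∃ v, ∃ m', HitsWith (coordsOf (insert c D)) w m' ∧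
        (v = Sum.inl c.1 ∧ (∀ g, m g ≤ m' g + if g = Sum.inr c.2 then 1 else 0) ∨
        v = Sum.inr c.2 ∧ (∀ g, m g ≤ m' g + if g = Sum.inl c.1 then 1 else 0)) := by
      obtain ⟨E, _, lam, P, hlam, hP, heq, hZ, hrk⟩ := hm
      have hz := hrk.eq_zero hw
      have hzero : ∀ y : (Fin n ⊕ Fin n) × Fin n, P y.1 (some y.2) = 0 →
          HitsWith (insert y (coordsOf D)) w m := fun y hy =>
        ⟨E, inferInstance, lam, P, hlam, hP, heq, fun g l hl => by
          rcases hl with hl | hl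
          · rw [← hl] at hy; exact hy
          · exact hZ g l hl, hrk⟩
      rcases mul_eq_zero.mp hz with hz | hz
      · have := (hzero (Sum.inl c.1, c.2) hz).slice (Sum.inr c.2) c.1
        rw [Set.insert_comm, ← coordsOf_insert] at this
        exact ⟨_, _, this, Or.inl ⟨rfl, fun g => by split_ifs <;> omega⟩⟩
      · have := (hzero (Sum.inr c.2, c.1) hz).slice (Sum.inl c.1) c.2
        rw [← coordsOf_insert] at this
        exact ⟨_, _, this, Or.inr ⟨rfl, fun g => by split_ifs <;> omega⟩⟩
    obtain ⟨ν, hν, hle⟩ := h.exists_mem_support m' hm'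
    refine ⟨Finsupp.single v 1 + ν, (mem_support_add_of_nonneg (hnn _) (hnn _)).mpr ?_,
      fun g => ?_⟩
    · rcases hmm' with ⟨rfl, -⟩ | ⟨rfl, -⟩
      · exact Or.inl (mem_support_X_mul.mpr ⟨ν, hν, rfl⟩)
      · exact Or.inr (mem_support_X_mul.mpr ⟨ν, hν, rfl⟩)
    · have h1 := hle g
      rw [freeCount_insert hc, Finsupp.add_apply, Finsupp.single_apply]
      rcases hmm' with ⟨rfl, h2⟩ | ⟨rfl, h2⟩
      · have h3 := h2 g
        simp only [eq_comm (a := Sum.inl c.1)]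
        omega
      · have h3 := h2 g
        simp only [eq_comm (a := Sum.inr c.2)]
        omega

open Classical in
theorem IsPeeled.sum_isCover {i : Fin n} (hc : (i, w i) ∉ D)
    {Q : Fin n → MvPolynomial (Fin n ⊕ Fin n) ℤ}
    (h : ∀ l, IsCover w i l → IsPeeled k (insert (i, w i) D) (w * Equiv.swap i l) (Q l))
    (hpre : ∀ r < i, (w r : ℕ) + r + 1 = n) (hi : (i : ℕ) + w i + 2 ≤ n) :
    IsPeeled k D w (∑ l, if IsCover w i l then Q l else 0) := by
  have hnn : ∀ ν, ∀ l ∈ Finset.univ, 0 ≤ coeff ν (if IsCover w i l then Q l else 0) := by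
    intro ν l _
    split_ifs with hl
    · exact (h l hl).coeff_nonneg ν
    · rw [coeff_zero]
  have hsupp : ∀ ν, ν ∈ (∑ l, if IsCover w i l then Q l else 0).support ↔
      ∃ l, IsCover w i l ∧ ν ∈ (Q l).support := by
    intro ν
    rw [mem_support_iff, coeff_sum, Ne, Finset.sum_eq_zero_iff_of_nonneg (hnn ν)]
    push Not
    refine exists_congr fun l => ?_
    by_cases hl : IsCover w i l <;> simp [hl]
  refine ⟨fun ν => by rw [coeff_sum]; exact Finset.sum_nonneg (hnn ν), fun ν hν => ?_,
    fun m hm => ?_⟩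
  · obtain ⟨l, hl, hν⟩ := (hsupp ν).mp hν
    obtain ⟨B, hBD, o, ho, hνB, hind⟩ := (h l hl).exists_cells ν hν
    have hcB : (i, w i) ∉ B := fun hcB =>
      Finset.disjoint_left.mp hBD hcB (Finset.mem_insert_self _ _)
    refine ⟨B, hBD.mono_right (Finset.subset_insert _ _), o, ho, hνB, ?_⟩
    have := algebraicIndependent_genericEntry_of_swap w hl.1 hl.2.1 (fun r hr => by
      have := hpre r hr
      rw [Fin.lt_def] at hr ⊢
      omega) hind
    have hset : {c | c ∉ B ∧ c ∉ D} = insert (i, w i) {c | c ∉ B ∧ c ∉ insert (i, w i) D} := by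
      ext c
      simp only [Set.mem_ofPred_eq, Set.mem_insert_iff, Finset.mem_insert]
      by_cases hci : c = (i, w i)
      · subst hci; simp [hcB, hc]
      · simp [hci]
    rwa [hset]
  · have h1 := (hm.slice (Sum.inr (w i)) i).slice (Sum.inl i) (w i)
    rw [← coordsOf_insert D (i, w i)] at h1
    obtain ⟨E, _, lam, P, hlam, hP, heq, hZ, hrk⟩ := h1
    have hz : P (Sum.inl i) (some (w i)) * P (Sum.inr (w i)) (some i) = 0 := by
      rw [hZ (Sum.inl i) (w i) (Finset.mem_insert_self _ _), zero_mul]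
    obtain ⟨l, hl, hrk'⟩ := hrk.exists_cover hpre rfl hi hz
    obtain ⟨ν, hν, hle⟩ := (h l hl).exists_mem_support _
      ⟨E, inferInstance, lam, P, hlam, hP, heq, hZ, hrk'⟩
    refine ⟨ν, (hsupp ν).mpr ⟨l, hl, hν⟩, fun g => ?_⟩
    have h2 := hle g
    rw [freeCount_insert hc]
    dsimp only at h2 ⊢
    split_ifs at h2 ⊢ <;> simp_all <;> omega

/-- The cells of the staircase which precede the position `q` in the reading order. -/
def staircaseBelow (n q : ℕ) : Finset (Fin n × Fin n) :=
  Finset.univ.filter fun c => (c.1 : ℕ) + c.2 + 2 ≤ n ∧ (c.1 : ℕ) * n + c.2 < q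

theorem mem_staircaseBelow {q : ℕ} {c : Fin n × Fin n} :
    c ∈ staircaseBelow n q ↔ (c.1 : ℕ) + c.2 + 2 ≤ n ∧ (c.1 : ℕ) * n + c.2 < q := by
  simp [staircaseBelow]

theorem isPeeled_staircase (k : Type) [Field k] :
    IsPeeled k (staircaseBelow n (n * n)) Fin.revPerm (1 : MvPolynomial (Fin n ⊕ Fin n) ℤ) := by
  classical
  refine ⟨fun ν => ?_, fun ν hν => ⟨∅, Finset.disjoint_empty_left _, fun c => Sum.inl c.1,
    fun c hc => absurd hc (Finset.notMem_empty _), fun g => ?_, ?_⟩,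
    fun m hm => ⟨0, ?_, fun g => ?_⟩⟩
  · rw [coeff_one]; split_ifs <;> simp
  · rw [mem_support_iff, coeff_one, ite_ne_right_iff] at hν
    simp [← hν.1]
  · refine algebraicIndependent_genericEntry_rev k fun c hc => ?_
    by_contra hlt
    refine hc.2 (mem_staircaseBelow.mpr ⟨by omega, ?_⟩)
    have h1 := c.1.2
    have h2 := c.2.2
    nlinarith
  · simp
  · have := hm.le_ncard g
    rw [Finsupp.zero_apply, add_zero]
    convert this
    rw [freeCount, ← Set.ncard_coe_finset]
    simp [coordsOf]

end Peeling

section Descent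

variable {n : ℕ} {P : Equiv.Perm (Fin n) → MvPolynomial (Fin n ⊕ Fin n) ℤ}

theorem apply_add_eq_of_staircase {w : Equiv.Perm (Fin n)} {N : ℕ}
    (h : ∀ r : Fin n, (r : ℕ) < N → ∀ c : Fin n, (r : ℕ) + c + 2 ≤ n → c < w r) (r : Fin n)
    (hr : (r : ℕ) < N) : (w r : ℕ) + r + 1 = n := by
  obtain ⟨m, hm⟩ : ∃ m, m = (r : ℕ) := ⟨_, rfl⟩
  induction m using Nat.strong_induction_on generalizing r with
  | _ m ih =>
    have h1 := apply_add_lt_of_initial (w := w) (i := r) (fun r' hr' => by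
      rw [Fin.lt_def] at hr'
      exact ih r' (by omega) r' (by omega) rfl) le_rfl
    by_cases h2 : (r : ℕ) + 2 ≤ n
    · have h3 := h r hr ⟨n - 2 - r, by omega⟩ (by dsimp; omega)
      rw [Fin.lt_def] at h3
      dsimp at h3
      omega
    · have := r.2
      omega

theorem staircaseBelow_succ_of_lt {i j : Fin n} (h : (i : ℕ) + j + 2 ≤ n) :
    staircaseBelow n ((i : ℕ) * n + j + 1) =
      insert (i, j) (staircaseBelow n ((i : ℕ) * n + j)) := by
  ext ⟨a, b⟩
  rw [Finset.mem_insert, mem_staircaseBelow, mem_staircaseBelow, Prod.mk.injEq]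
  dsimp only
  constructor
  · rintro ⟨h1, h2⟩
    by_cases h3 : (a : ℕ) * n + b < i * n + j
    · exact Or.inr ⟨h1, h3⟩
    · left
      have h4 : (a : ℕ) * n + b = i * n + j := by omega
      have h5 := congrArg (· / n) h4
      have h6 := congrArg (· % n) h4
      have hn : 0 < n := by omega
      simp only [mul_comm _ n, Nat.mul_add_div hn, Nat.mul_add_mod, Nat.div_eq_of_lt b.2,
        Nat.div_eq_of_lt j.2, Nat.mod_eq_of_lt b.2, Nat.mod_eq_of_lt j.2, add_zero] at h5 h6
      exact ⟨Fin.ext h5, Fin.ext h6⟩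
  · rintro (⟨rfl, rfl⟩ | ⟨h1, h2⟩)
    · exact ⟨h, by omega⟩
    · exact ⟨h1, by omega⟩

theorem staircaseBelow_succ_of_not_lt {i j : Fin n} (h : ¬ (i : ℕ) + j + 2 ≤ n) :
    staircaseBelow n ((i : ℕ) * n + j + 1) = staircaseBelow n ((i : ℕ) * n + j) := by
  ext ⟨a, b⟩
  rw [mem_staircaseBelow, mem_staircaseBelow]
  dsimp only
  refine and_congr_right fun h1 => ⟨fun h2 => ?_, fun h2 => by omega⟩
  by_contra h3
  have h4 : (a : ℕ) * n + b = i * n + j := by omega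
  have h5 := congrArg (· / n) h4
  have h6 := congrArg (· % n) h4
  have hn : 0 < n := by omega
  simp only [mul_comm _ n, Nat.mul_add_div hn, Nat.mul_add_mod, Nat.div_eq_of_lt b.2,
    Nat.div_eq_of_lt j.2, Nat.mod_eq_of_lt b.2, Nat.mod_eq_of_lt j.2, add_zero] at h5 h6
  omega

theorem X_inl_add_X_inr_ne_zero (i j : Fin n) :
    (X (Sum.inl i) + X (Sum.inr j) : MvPolynomial (Fin n ⊕ Fin n) ℤ) ≠ 0 := by
  intro h
  have := congrArg (eval (fun _ => (1 : ℤ))) h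
  simp at this

theorem IsPositiveFamily.exists_isPeeled (hP : IsPositiveFamily P) (k : Type) [Field k] {q : ℕ}
    (hq : q ≤ n * n) (w : Equiv.Perm (Fin n)) (hw : ∀ c ∈ staircaseBelow n q, c.2 < w c.1) :
    ∃ Q, IsPeeled k (staircaseBelow n q) w Q ∧
      (∏ c ∈ staircaseBelow n q, (X (Sum.inl c.1) + X (Sum.inr c.2))) * Q = P w := by
  classical
  induction hq using Nat.decreasingInduction generalizing w with
  | self =>
    have hmem : ∀ c : Fin n × Fin n, c ∈ staircaseBelow n (n * n) ↔ (c.1 : ℕ) + c.2 + 2 ≤ n := by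
      intro c
      rw [mem_staircaseBelow, and_iff_left_iff_imp]
      intro
      have h1 := c.1.2
      have h2 := c.2.2
      nlinarith
    have hrev : w = Fin.revPerm := by
      ext r
      have := apply_add_eq_of_staircase (w := w) (N := n)
        (fun r _ c hc => hw (r, c) ((hmem _).mpr hc)) r r.2
      rw [Fin.revPerm_apply, Fin.val_rev]
      omega
    subst hrev
    refine ⟨1, isPeeled_staircase k, ?_⟩
    rw [mul_one, hP.rev]
    refine Finset.prod_congr ?_ fun _ _ => rfl
    ext c
    rw [hmem, Finset.mem_filter, and_iff_right (Finset.mem_univ _)]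
  | of_succ q hq ih =>
    have hn : 0 < n := by
      rcases Nat.eq_zero_or_pos n with rfl | h
      · simp at hq
      · exact h
    obtain ⟨i, j, rfl⟩ : ∃ i j : Fin n, (i : ℕ) * n + j = q :=
      ⟨⟨q / n, Nat.div_lt_of_lt_mul hq⟩, ⟨q % n, Nat.mod_lt _ hn⟩, Nat.div_add_mod' q n⟩
    by_cases hij : (i : ℕ) + j + 2 ≤ n
    swap
    · rw [staircaseBelow_succ_of_not_lt hij] at ih
      exact ih w hw
    have hc : (i, j) ∉ staircaseBelow n ((i : ℕ) * n + j) := fun h =>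
      lt_irrefl _ (mem_staircaseBelow.mp h).2
    have hpre : ∀ r < i, (w r : ℕ) + r + 1 = n := apply_add_eq_of_staircase fun r hr c hrc =>
      hw (r, c) (mem_staircaseBelow.mpr ⟨hrc, by
        have := c.2
        dsimp
        nlinarith⟩)
    have hji : j ≤ w i := by
      by_contra! h
      exact lt_irrefl _ (hw (i, w i) (mem_staircaseBelow.mpr (by
        rw [Fin.lt_def] at h; dsimp; omega)))
    rw [staircaseBelow_succ_of_lt hij] at ih
    rcases hji.lt_or_eq with hlt | rfl
    · obtain ⟨Q, hQ, hprod⟩ := ih w fun c hc => by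
        rcases Finset.mem_insert.mp hc with rfl | hc
        · exact hlt
        · exact hw c hc
      refine ⟨_, hQ.mul_X_add_X hc fun a ha => ?_, ?_⟩
      · rcases ha.lt_or_eq with ha | rfl
        · have := hpre a ha
          dsimp only at ha ⊢
          rw [Fin.lt_def] at ha ⊢
          omega
        · exact hlt
      · rw [← hprod, Finset.prod_insert hc]
        ring
    · have hex : ∀ l, ∃ Q, IsCover w i l →
          IsPeeled k (insert (i, w i) (staircaseBelow n ((i : ℕ) * n + w i)))
            (w * Equiv.swap i l) Q ∧
          (∏ c ∈ insert (i, w i) (staircaseBelow n ((i : ℕ) * n + w i)),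
            (X (Sum.inl c.1) + X (Sum.inr c.2))) * Q = P (w * Equiv.swap i l) := by
        intro l
        by_cases hl : IsCover w i l
        · obtain ⟨Q, hQ⟩ := ih (w * Equiv.swap i l) fun c hc' => by
            have hle : (c.1 : ℕ) * n + c.2 ≤ i * n + w i := by
              rcases Finset.mem_insert.mp hc' with rfl | hc'
              · exact le_rfl
              · exact (mem_staircaseBelow.mp hc').2.le
            have hci : c.1 ≤ i := by
              by_contra! h
              rw [Fin.lt_def] at h
              have := (w i).2
              nlinarith
            rcases hci.lt_or_eq with hci' | hci'
            · rw [Equiv.Perm.mul_apply,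
                Equiv.swap_apply_of_ne_of_ne hci'.ne (hci'.trans hl.1).ne]
              rcases Finset.mem_insert.mp hc' with rfl | hc'
              · exact absurd hci' (lt_irrefl _)
              · exact hw c hc'
            · rw [Equiv.Perm.mul_apply, hci', Equiv.swap_apply_left]
              refine lt_of_le_of_lt ?_ hl.2.1
              rw [hci'] at hle
              rw [Fin.le_def]
              omega
          exact ⟨Q, fun _ => hQ⟩
        · exact ⟨0, fun h => absurd h hl⟩
      choose Q hQ using hex
      refine ⟨_, IsPeeled.sum_isCover hc (fun l hl => (hQ l hl).1) hpre hij, ?_⟩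
      refine mul_left_cancel₀ (X_inl_add_X_inr_ne_zero i (w i)) ?_
      rw [hP.cotransition hpre hij, ← mul_assoc, ← Finset.prod_insert hc
        (f := fun c : Fin n × Fin n => (X (Sum.inl c.1) + X (Sum.inr c.2) :
          MvPolynomial (Fin n ⊕ Fin n) ℤ)), Finset.mul_sum]
      refine Finset.sum_congr rfl fun l _ => ?_
      split_ifs with hl
      · exact (hQ l hl).2
      · rw [mul_zero]

theorem IsPositiveFamily.isPeeled (hP : IsPositiveFamily P) (k : Type) [Field k]
    (w : Equiv.Perm (Fin n)) : IsPeeled k ∅ w (P w) := by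
  have h0 : staircaseBelow n 0 = ∅ := by ext; simp [mem_staircaseBelow]
  obtain ⟨Q, hQ, hprod⟩ := hP.exists_isPeeled k (Nat.zero_le _) w (by simp [h0])
  rw [h0, Finset.prod_empty, one_mul] at hprod
  rwa [h0, hprod] at hQ

end Descent

section Rado

variable {α : Type*}

/-- The rank of a finite set in a matroid, as a natural number. -/
noncomputable def Matroid.finsetRank (N : Matroid α) (A : Finset α) : ℕ := (N.eRk A).toNat

theorem Matroid.coe_finsetRank (N : Matroid α) (A : Finset α) :
    (N.finsetRank A : ℕ∞) = N.eRk A := by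
  refine ENat.natCast_toNat ((N.eRk_le_encard A).trans_lt ?_).ne
  rw [Set.encard_coe_eq_coe_finsetCard]
  exact ENat.natCast_lt_top _

theorem Matroid.Indep.card_le_finsetRank {N : Matroid α} {I A : Finset α} (hI : N.Indep I)
    (hIA : I ⊆ A) : I.card ≤ N.finsetRank A := by
  have := hI.encard_le_eRk_of_subset (Finset.coe_subset.mpr hIA)
  rw [Set.encard_coe_eq_coe_finsetCard, ← N.coe_finsetRank] at this
  exact_mod_cast this

theorem Matroid.exists_isBase_of_sum_le [DecidableEq α] (N : Matroid α) {G : Type*} [Fintype G]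
    [DecidableEq G] (T : G → Finset α) (o₀ : α → G) (x : G → ℕ) {B₀ : Finset α} (hB₀ : N.IsBase B₀)
    (hx : ∑ g, x g = B₀.card) (h : ∀ S : Finset G, ∑ g ∈ S, x g ≤ N.finsetRank (S.biUnion T)) :
    ∃ (B : Finset α) (o : α → G), N.IsBase B ∧ (∀ c ∈ B, c ∈ T (o c)) ∧
      ∀ g, x g = (B.filter fun c => o c = g).card := by
  obtain ⟨f, hf, hcard⟩ := exists_transversal_of_card_le_biUnion (ι := Σ g, Fin (x g)) N.finsetRank
    (by simp [finsetRank])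
    (fun A B hAB => by
      have := N.eRk_mono (Finset.coe_subset.mpr hAB)
      rw [← N.coe_finsetRank, ← N.coe_finsetRank] at this
      exact_mod_cast this)
    (fun A B => by
      have := N.eRk_inter_add_eRk_union_le A B
      rw [← Finset.coe_inter, ← Finset.coe_union, ← N.coe_finsetRank, ← N.coe_finsetRank,
        ← N.coe_finsetRank, ← N.coe_finsetRank] at this
      rw [add_comm]
      exact_mod_cast this)
    (fun e => T e.1)
    (fun J => by
      have h1 : J.biUnion (fun e => T e.1) = (J.image Sigma.fst).biUnion T := by
        rw [Finset.image_biUnion]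
      rw [h1]
      refine le_trans ?_ (h _)
      have h2 : J ⊆ (J.image Sigma.fst).sigma fun g => (Finset.univ : Finset (Fin (x g))) :=
        fun e he => Finset.mem_sigma.mpr ⟨Finset.mem_image_of_mem _ he, Finset.mem_univ _⟩
      refine (Finset.card_le_card h2).trans ?_
      rw [Finset.card_sigma]
      simp)
  have hle : N.finsetRank (Finset.univ.image f) ≤ (Finset.univ.image f).card := by
    have := N.eRk_le_encard (Finset.univ.image f : Finset α)
    rw [Set.encard_coe_eq_coe_finsetCard, ← N.coe_finsetRank] at this
    exact_mod_cast this
  have hcard' : (Finset.univ.image f).card = Fintype.card (Σ g, Fin (x g)) :=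
    le_antisymm Finset.card_image_le (hcard.trans hle)
  have hinj : Function.Injective f := by
    rw [← Set.injOn_univ, ← Finset.coe_univ]
    exact Finset.card_image_iff.mp hcard'
  have hrank : N.eRk (Finset.univ.image f : Finset α) =
      (Finset.univ.image f : Finset α).card := by
    rw [← N.coe_finsetRank]
    exact congrArg _ (le_antisymm hle (hcard'.le.trans hcard))
  have hindep : N.Indep (Finset.univ.image f : Finset α) := by
    rw [N.indep_iff_eRk_eq_encard_of_finite (Finset.finite_toSet _), hrank,
      Set.encard_coe_eq_coe_finsetCard]
  have hT : Fintype.card (Σ g, Fin (x g)) = B₀.card := by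
    rw [Fintype.card_sigma, ← hx]
    simp
  refine ⟨Finset.univ.image f, Function.extend f Sigma.fst o₀,
    hindep.isBase_of_eRk_ge (Finset.finite_toSet _) ?_, fun c hc => ?_, fun g => ?_⟩
  · rw [hrank, ← hB₀.encard_eq_eRank, Set.encard_coe_eq_coe_finsetCard, hcard', hT]
  · obtain ⟨e, -, rfl⟩ := Finset.mem_image.mp hc
    rw [hinj.extend_apply]
    exact hf e
  · rw [Finset.filter_image, Finset.card_image_of_injective _ hinj]
    simp only [hinj.extend_apply]
    rw [← Fintype.card_fin (x g), ← Fintype.card_subtype]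
    exact Fintype.card_congr
      ⟨fun a => ⟨⟨g, a⟩, rfl⟩, fun e => e.2 ▸ e.1.2, fun _ => rfl,
        fun ⟨⟨_, _⟩, h⟩ => by subst h; rfl⟩

end Rado

section Saturation

variable {n : ℕ}

/-- The cells of the group `g`. -/
def cellsOf (g : Fin n ⊕ Fin n) : Finset (Fin n × Fin n) := Finset.univ.image (cellOf g)

theorem mem_cellsOf {g : Fin n ⊕ Fin n} {c : Fin n × Fin n} :
    c ∈ cellsOf g ↔ g = Sum.inl c.1 ∨ g = Sum.inr c.2 := by
  rw [cellsOf, Finset.mem_image]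
  simp only [Finset.mem_univ, true_and, cellOf_eq_iff, Prod.mk.injEq]
  constructor
  · rintro ⟨l, h | h⟩
    · exact Or.inl h.1
    · exact Or.inr h.1
  · rintro (h | h)
    · exact ⟨_, Or.inl ⟨h, rfl⟩⟩
    · exact ⟨_, Or.inr ⟨h, rfl⟩⟩

theorem cellOf_injective (g : Fin n ⊕ Fin n) : Function.Injective (cellOf g) := by
  rcases g with i | j
  · exact fun a b h => (Prod.mk.inj h).2
  · exact fun a b h => (Prod.mk.inj h).1

theorem card_filter_cellOf_add {B : Finset (Fin n × Fin n)} {o : Fin n × Fin n → Fin n ⊕ Fin n}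
    (ho : ∀ c ∈ B, o c = Sum.inl c.1 ∨ o c = Sum.inr c.2) (g : Fin n ⊕ Fin n) :
    (Finset.univ.filter fun l => ¬ (cellOf g l ∈ B ∧ o (cellOf g l) = g)).card +
      (B.filter fun c => o c = g).card = n := by
  have h1 : B.filter (fun c => o c = g) =
      (Finset.univ.filter fun l => cellOf g l ∈ B ∧ o (cellOf g l) = g).image (cellOf g) := by
    ext c
    simp only [Finset.mem_filter, Finset.mem_image, Finset.mem_univ, true_and]
    constructor
    · rintro ⟨hc, hoc⟩
      obtain ⟨l, -, rfl⟩ := Finset.mem_image.mp (mem_cellsOf.mpr (hoc ▸ ho c hc) : c ∈ cellsOf g)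
      exact ⟨l, ⟨hc, hoc⟩, rfl⟩
    · rintro ⟨l, h, rfl⟩
      exact h
  rw [h1, Finset.card_image_of_injective _ (cellOf_injective g), add_comm,
    Finset.card_filter_add_card_filter_not, Finset.card_univ, Fintype.card_fin]

theorem IsPeeled.mem_support_of_mem_convexHull {K : Type} [Field K] {η : Fin n × Fin n → K}
    (hη : AlgebraicIndependent ℤ η) {w : Equiv.Perm (Fin n)}
    {Q : MvPolynomial (Fin n ⊕ Fin n) ℤ} (hQ : IsPeeled K ∅ w Q) {d : ℕ} (hd : Q.IsHomogeneous d)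
    {x : (Fin n ⊕ Fin n) →₀ ℕ}
    (hx : (fun v => (x v : ℝ)) ∈ convexHull ℝ {y : (Fin n ⊕ Fin n) → ℝ |
      ∃ m ∈ Q.support, y = fun v => (m v : ℝ)}) : x ∈ Q.support := by
  classical
  obtain ⟨M, hME, hM⟩ : ∃ M : Matroid (Fin n × Fin n), M.E = Set.univ ∧
      ∀ I, M.Indep I ↔ AlgebraicIndependent K fun c : I => genericEntry K w c := by
    refine ⟨(AlgebraicIndependent.matroid K (MvPolynomial
      ((Fin n × Fin n) ⊕ (Fin n × Fin n)) K)).comap (genericEntry K w), rfl, fun I => ?_⟩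
    rw [Matroid.comap_indep_iff, AlgebraicIndependent.matroid_indep_iff]
    constructor
    · rintro ⟨h1, h2⟩
      exact (algebraicIndependent_image h2).mpr h1
    · intro h
      have h2 : Set.InjOn (genericEntry K w) I := Set.injOn_iff_injective.mpr h.injective
      exact ⟨(algebraicIndependent_image h2).mp h, h2⟩
  have hcompl : ∀ B : Finset (Fin n × Fin n), M✶.IsBase B ↔ M.IsBase (Bᶜ : Finset _) := fun B => by
    rw [Matroid.dual_isBase_iff', hME, Finset.coe_compl, Set.compl_eq_univ_sdiff]
    simp
  have hν_card : ∀ ν ∈ Q.support, ∑ g, ν g = d := fun ν hν => by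
    have := hd (mem_support_iff.mp hν)
    rw [← Finsupp.degree_eq_sum, Finsupp.degree_eq_weight_one]
    exact this
  have hweight : ∀ (B : Finset (Fin n × Fin n)) (o : Fin n × Fin n → Fin n ⊕ Fin n),
      ∑ g, (B.filter fun c => o c = g).card = B.card := fun B o =>
    (Finset.card_eq_sum_card_fiberwise fun _ _ => Finset.mem_univ _).symm
  have hhits : ∀ B : Finset (Fin n × Fin n), M✶.IsBase B → ∀ o : Fin n × Fin n → Fin n ⊕ Fin n,
      (∀ c ∈ B, o c = Sum.inl c.1 ∨ o c = Sum.inr c.2) →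
      ∃ ν ∈ Q.support, ∀ g, ν g ≤ (B.filter fun c => o c = g).card := fun B hB o ho => by
    have hind : AlgebraicIndependent K fun c : {c // c ∉ B} => genericEntry K w c := by
      have := (hM _).mp ((hcompl B).mp hB).indep
      rw [Finset.coe_compl] at this
      exact this
    have hempty : coordsOf (∅ : Finset (Fin n × Fin n)) = ∅ := by
      ext; simp [coordsOf]
    obtain ⟨ν, hν, hle⟩ := hQ.exists_mem_support _
      (by rw [hempty]; exact hitsWith_empty_of_algebraicIndependent_compl hη hind ho)
    refine ⟨ν, hν, fun g => ?_⟩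
    have h1 := hle g
    have h2 := card_filter_cellOf_add ho g
    have h3 : freeCount (∅ : Finset (Fin n × Fin n)) g = n := by simp [freeCount]
    omega
  have hspan : ∀ ν ∈ Q.support, ∃ B : Finset (Fin n × Fin n),
      ∃ o : Fin n × Fin n → Fin n ⊕ Fin n, (∀ c ∈ B, o c = Sum.inl c.1 ∨ o c = Sum.inr c.2) ∧
        (∀ g, ν g = (B.filter fun c => o c = g).card) ∧
        ∃ B' ⊆ B, M✶.IsBase (B' : Finset (Fin n × Fin n)) := fun ν hν => by
    obtain ⟨B, -, o, ho, hνB, hind⟩ := hQ.exists_cells ν hν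
    refine ⟨B, o, ho, hνB, ?_⟩
    obtain ⟨C, hC, hBC⟩ := ((hM _).mpr hind).exists_isBase_superset
    refine ⟨C.toFinsetᶜ, fun c hc => ?_, ?_⟩
    · by_contra hcB
      rw [Finset.mem_compl, Set.mem_toFinset] at hc
      exact hc (hBC ⟨hcB, Finset.notMem_empty _⟩)
    · rw [hcompl, compl_compl, Set.coe_toFinset]
      exact hC
  obtain ⟨B₀, hB₀⟩ : ∃ B₀ : Finset (Fin n × Fin n), M✶.IsBase B₀ := by
    obtain ⟨C, hC⟩ := M✶.exists_isBase
    exact ⟨C.toFinset, by rwa [Set.coe_toFinset]⟩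
  have hbase_card : ∀ B : Finset (Fin n × Fin n), M✶.IsBase B → B.card = B₀.card := fun B hB => by
    simpa using hB.ncard_eq_ncard_of_isBase hB₀
  have hd_le : ∀ ν ∈ Q.support, B₀.card ≤ d := fun ν hν => by
    obtain ⟨B, o, -, hνB, B', hB', hbase⟩ := hspan ν hν
    rw [← hbase_card B' hbase, ← hν_card ν hν]
    simp only [hνB, hweight]
    exact Finset.card_le_card hB'
  have hd_eq : d = B₀.card := by
    obtain ⟨ν, hν, hle⟩ := hhits B₀ hB₀ (fun c => Sum.inl c.1) fun _ _ => Or.inl rfl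
    refine le_antisymm ?_ (hd_le ν hν)
    rw [← hν_card ν hν, ← hweight B₀ fun c => Sum.inl c.1]
    exact Finset.sum_le_sum fun g _ => hle g
  have hbound : ∀ ν ∈ Q.support, ∀ S : Finset (Fin n ⊕ Fin n),
      ∑ g ∈ S, ν g ≤ M✶.finsetRank (S.biUnion cellsOf) := fun ν hν S => by
    obtain ⟨B, o, ho, hνB, B', hB', hbase⟩ := hspan ν hν
    have hBB' : B' = B := Finset.eq_of_subset_of_card_le hB' (by
      rw [hbase_card B' hbase, ← hd_eq, ← hν_card ν hν]
      simp only [hνB, hweight, le_refl])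
    subst hBB'
    have h1 : ∑ g ∈ S, ν g = (B'.filter fun c => o c ∈ S).card := by
      have hmaps : Set.MapsTo o (B'.filter fun c => o c ∈ S : Finset _) S := fun c hc =>
        (Finset.mem_filter.mp hc).2
      have := Finset.card_eq_sum_card_fiberwise hmaps
      rw [this]
      refine Finset.sum_congr rfl fun g hg => ?_
      rw [hνB g, Finset.filter_filter]
      congr 1
      refine Finset.filter_congr fun c _ => ⟨fun h => ⟨h ▸ hg, h⟩, fun h => h.2⟩
    rw [h1]
    refine Matroid.Indep.card_le_finsetRank
      (hbase.indep.subset (Finset.coe_subset.mpr (Finset.filter_subset _ _))) fun c hc => ?_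
    obtain ⟨hcB, hcS⟩ := Finset.mem_filter.mp hc
    exact Finset.mem_biUnion.mpr ⟨o c, hcS, mem_cellsOf.mpr (ho c hcB)⟩
  have hpoly : (fun v => (x v : ℝ)) ∈ {y : (Fin n ⊕ Fin n) → ℝ |
      (∀ S : Finset (Fin n ⊕ Fin n), ∑ g ∈ S, y g ≤ M✶.finsetRank (S.biUnion cellsOf)) ∧
        ∑ g, y g = d} := by
    refine convexHull_min ?_ ?_ hx
    · rintro _ ⟨ν, hν, rfl⟩
      exact ⟨fun S => by beta_reduce; exact_mod_cast hbound ν hν S,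
        by beta_reduce; exact_mod_cast hν_card ν hν⟩
    · intro y hy z hz a b ha hb hab
      have hsum : ∀ S : Finset (Fin n ⊕ Fin n), ∑ g ∈ S, (a • y + b • z) g =
          a * ∑ g ∈ S, y g + b * ∑ g ∈ S, z g := fun S => by
        simp [Finset.sum_add_distrib, Finset.mul_sum]
      refine ⟨fun S => ?_, ?_⟩
      · rw [hsum]
        have h1 := mul_le_mul_of_nonneg_left (hy.1 S) ha
        have h2 := mul_le_mul_of_nonneg_left (hz.1 S) hb
        have h3 : a = 1 - b := by linarith
        subst h3
        linarith
      · rw [hsum, hy.2, hz.2, ← add_mul, hab, one_mul]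
  obtain ⟨hxS, hxd⟩ := hpoly
  beta_reduce at hxS hxd
  have hxd' : ∑ g, x g = d := by exact_mod_cast hxd
  obtain ⟨B, o, hB, ho, hxB⟩ := M✶.exists_isBase_of_sum_le cellsOf (fun c => Sum.inl c.1) x hB₀
    (hxd'.trans hd_eq) fun S => by exact_mod_cast hxS S
  obtain ⟨ν, hν, hle⟩ := hhits B hB o fun c hc => mem_cellsOf.mp (ho c hc)
  have hle' : ∀ g ∈ Finset.univ, ν g ≤ x g := fun g _ => (hle g).trans_eq (hxB g).symm
  have hνx : ν = x := by
    ext g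
    exact (Finset.sum_eq_sum_iff_of_le hle').mp ((hν_card ν hν).trans hxd'.symm) g
      (Finset.mem_univ g)
  rwa [← hνx]

end Saturation

theorem coeff_aeval_neg_inr {n : ℕ} (f : MvPolynomial (Fin n ⊕ Fin n) ℤ)
    (ν : (Fin n ⊕ Fin n) →₀ ℕ) :
    coeff ν (aeval (Sum.elim (fun i => X (Sum.inl i)) fun j => -X (Sum.inr j)) f :
      MvPolynomial (Fin n ⊕ Fin n) ℤ) = (∏ j, (-1) ^ ν (Sum.inr j)) * coeff ν f := by
  induction f using MvPolynomial.induction_on' with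
  | monomial m a =>
    have : (aeval (Sum.elim (fun i => X (Sum.inl i)) fun j => -X (Sum.inr j)) (monomial m a) :
        MvPolynomial (Fin n ⊕ Fin n) ℤ) = C (∏ j, (-1) ^ m (Sum.inr j)) * monomial m a := by
      rw [aeval_monomial, monomial_eq, Finsupp.prod_fintype _ _ (by simp),
        Finsupp.prod_fintype _ _ (by simp), Fintype.prod_sum_type, Fintype.prod_sum_type]
      simp only [Sum.elim_inl, Sum.elim_inr, neg_pow (X _ : MvPolynomial (Fin n ⊕ Fin n) ℤ),
        Finset.prod_mul_distrib, map_prod, map_pow, map_neg, map_one, algebraMap_eq]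
      ring
    rw [this, coeff_C_mul, coeff_monomial]
    split_ifs with h
    · rw [h]
    · simp
  | add f g hf hg => rw [map_add, coeff_add, coeff_add, hf, hg, mul_add]

theorem support_aeval_neg_inr {n : ℕ} (f : MvPolynomial (Fin n ⊕ Fin n) ℤ) :
    (aeval (Sum.elim (fun i => X (Sum.inl i)) fun j => -X (Sum.inr j)) f :
      MvPolynomial (Fin n ⊕ Fin n) ℤ).support = f.support := by
  ext ν
  rw [mem_support_iff, mem_support_iff, coeff_aeval_neg_inr, mul_ne_zero_iff,
    and_iff_right (Finset.prod_ne_zero_iff.mpr fun j _ => pow_ne_zero _ (by simp))]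

theorem algebraicIndependent_int_of_injective {ι A : Type*} [CommRing A]
    (φ : MvPolynomial ι ℤ →+* A) (hφ : Function.Injective φ) :
    AlgebraicIndependent ℤ fun i => φ (X i) := by
  refine algebraicIndependent_iff.mpr fun f hf => hφ ?_
  rw [map_zero, ← hf, aeval_def, ← coe_eval₂Hom]
  refine congrArg (fun ψ : MvPolynomial ι ℤ →+* A => ψ f) (ringHom_ext (fun r => ?_) fun i => ?_)
  all_goals simp

theorem exists_field_algebraicIndependent_int (ι : Type) :
    ∃ (K : Type) (_ : Field K) (η : ι → K), AlgebraicIndependent ℤ η :=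
  ⟨FractionRing (MvPolynomial ι ℤ), inferInstance, _,
    algebraicIndependent_int_of_injective (algebraMap _ _) (IsFractionRing.injective _ _)⟩

/-- **Conjecture 5.2 of Monical–Tokcan–Yong** (now a theorem): double Schubert polynomials
have the Saturated Newton Polytope property, i.e. the support of `𝔖_π` consists exactly of
the lattice points of its Newton polytope (the convex hull of its support). -/
theorem doubleSchubert_saturatedNewtonPolytope
    (p : ℕ) (hp : 1 ≤ p)
    (𝔖 : Equiv.Perm (Fin p) → MvPolynomial (Fin p ⊕ Fin p) ℤ)
    (h𝔖 : IsDoubleSchubertFamily p 𝔖) (π : Equiv.Perm (Fin p)) :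
    ∀ x : (Fin p ⊕ Fin p) →₀ ℕ,
      x ∈ (𝔖 π).support ↔
        (fun v => (x v : ℝ)) ∈
          convexHull ℝ {y : (Fin p ⊕ Fin p) → ℝ |
            ∃ m ∈ (𝔖 π).support, y = fun v => (m v : ℝ)} := by
  intro x
  refine ⟨fun hx => subset_convexHull ℝ _ ⟨x, hx, rfl⟩, fun hx => ?_⟩
  obtain ⟨K, _, η, hη⟩ := exists_field_algebraicIndependent_int (Fin p × Fin p)
  have hP := h𝔖.isPositiveFamily
  obtain ⟨d, hd⟩ := hP.exists_isHomogeneous π⁻¹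
  have hmem := IsPeeled.mem_support_of_mem_convexHull (x := x) hη (hP.isPeeled K π⁻¹) hd
  simp only [inv_inv, support_aeval_neg_inr] at hmem
  exact hmem hx
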